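/- Assume condition (C). Then as n → ∞, n² · ( P(P_n has a double root in ℂ) − P(−1, 0, or 1 is a double root of P_n) ) → 0. In other words, the probability that P_n has a double root equals the probability that at least one of −1, 0, 1 is a double root of P_n, up to an error of o(n^{-2}). -/

import Mathlib

open Filter MeasureTheory

/-- The polynomial `∑_{j=0}^n a_j z^j` with integer coefficients, viewed over `ℂ`. -/
noncomputable def polyOf (n : ℕ) (a : Fin (n + 1) → ℤ) : Polynomial ℂ :=
  ∑ j : Fin (n + 1), Polynomial.C (a j : ℂ) * Polynomial.X ^ (j : ℕ)

/-- `z` is a double root of the polynomial with coefficients `a`. -/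
def isDoubleRootAt (n : ℕ) (a : Fin (n + 1) → ℤ) (z : ℂ) : Prop :=
  (polyOf n a).eval z = 0 ∧ (Polynomial.derivative (polyOf n a)).eval z = 0

/-- The polynomial with coefficients `a` has a double root in `ℂ`. -/
def hasDoubleRoot (n : ℕ) (a : Fin (n + 1) → ℤ) : Prop :=
  ∃ z : ℂ, isDoubleRootAt n a z


lemma exists_sum_pow_prime {ι R : Type*} [CommRing R] {p : ℕ} (hp : p.Prime) (s : Finset ι) (y : ι → R) :
    ∃ r : R, (∑ i ∈ s, y i) ^ p = ∑ i ∈ s, y i ^ p + p * r := by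
  classical
  induction s using Finset.induction_on with
  | empty => exact ⟨0, by simp [hp.ne_zero]⟩
  | insert a s ha ih =>
    obtain ⟨r, hr⟩ := ih
    obtain ⟨r', hr'⟩ := exists_add_pow_prime_eq hp (y a) (∑ i ∈ s, y i)
    refine ⟨r + y a * (∑ i ∈ s, y i) * r', ?_⟩
    rw [Finset.sum_insert ha, Finset.sum_insert ha, hr', hr]; ring

lemma int_of_integral_rat (w : ℂ) (hw : IsIntegral ℤ w) (q : ℚ) (hq : (q : ℂ) = w) : ∃ m : ℤ, (m : ℂ) = w := by
  have h : IsIntegral ℤ q := by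
    rw [← hq] at hw
    have := (isIntegral_algHom_iff (Algebra.ofId ℚ ℂ |>.restrictScalars ℤ) (algebraMap ℚ ℂ).injective (x := q)).1
    exact this (by simpa using hw)
  obtain ⟨m, hm⟩ := IsIntegrallyClosed.isIntegral_iff.1 h
  refine ⟨m, ?_⟩
  rw [← hq, ← hm]; simp

lemma powsum_int {K : Type*} [Field K] [NumberField K] (x : K) (hx : IsIntegral ℤ x) (j : ℕ) :
    ∃ m : ℤ, (m : ℂ) = ∑ σ : K →ₐ[ℚ] ℂ, (σ x) ^ j := by
  have h := trace_eq_sum_embeddings (K := ℚ) (L := K) ℂ (x := x ^ j)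
  simp only [map_pow] at h
  refine int_of_integral_rat _ ?_ _ h
  refine IsIntegral.sum _ fun σ _ => ?_
  exact (hx.map (σ.restrictScalars ℤ)).pow j

lemma powsum_congr {K : Type*} [Field K] [NumberField K] (x : K) (hx : IsIntegral ℤ x) (j : ℕ)
    {p : ℕ} (hp : p.Prime) (s t : ℤ) (hs : (s : ℂ) = ∑ σ : K →ₐ[ℚ] ℂ, (σ x) ^ j)
    (ht : (t : ℂ) = ∑ σ : K →ₐ[ℚ] ℂ, (σ x) ^ (j * p)) : (p : ℤ) ∣ t - s := by
  have hy : ∀ σ : K →ₐ[ℚ] ℂ, IsIntegral ℤ ((σ x) ^ j) := fun σ =>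
    (hx.map (σ.restrictScalars ℤ)).pow j
  obtain ⟨r, hr⟩ := exists_sum_pow_prime hp Finset.univ
    (fun σ : K →ₐ[ℚ] ℂ => (⟨(σ x) ^ j, hy σ⟩ : integralClosure ℤ ℂ))
  have hr2 := congrArg (Subtype.val) hr
  push_cast at hr2
  simp only [← pow_mul] at hr2
  rw [← hs, ← ht] at hr2
  have hp0 : (p : ℂ) ≠ 0 := by exact_mod_cast hp.ne_zero
  obtain ⟨m, hm⟩ := int_of_integral_rat r.1 r.2 ((s ^ p - t) / p) (by
    push_cast; rw [hr2]; field_simp; ring)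
  have h1 : s ^ p - t = p * m := by
    have : ((s ^ p - t : ℤ) : ℂ) = ((p * m : ℤ) : ℂ) := by push_cast; rw [hr2, hm]; ring
    exact_mod_cast this
  have h2 : (p : ℤ) ∣ s ^ p - s := by
    have := Fact.mk hp
    rw [← ZMod.intCast_zmod_eq_zero_iff_dvd] 
    push_cast
    rw [ZMod.pow_card]; simp
  have : t - s = (s ^ p - s) - p * m := by rw [← h1]; ring
  rw [this]
  exact dvd_sub h2 ⟨m, rfl⟩

lemma dobrowolski {K : Type*} [Field K] [NumberField K] (x : K) (hx : IsIntegral ℤ x) (hx0 : x ≠ 0)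
    (N : ℕ) (hN : 1 ≤ N) (hd : Module.finrank ℚ K ≤ N) {p : ℕ} (hp : p.Prime) (hpN : 6 * N < p)
    (hb : ∀ σ : K →ₐ[ℚ] ℂ, ‖σ x‖ ≤ 1 + 1 / (2 * N * p)) : ∃ m : ℕ, 0 < m ∧ x ^ m = 1 := by
  classical
  have hcard : Fintype.card (K →ₐ[ℚ] ℂ) ≤ N := by
    rw [AlgHom.card]; exact hd
  have hp0 : (0:ℝ) < p := by exact_mod_cast hp.pos
  have hN0 : (0:ℝ) < N := by exact_mod_cast hN
  choose s hs using powsum_int x hx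
  have hsb : ∀ j, j ≤ 2 * N * p → |(s j : ℝ)| ≤ N * 2.72 := by
    intro j hj
    have : |(s j : ℝ)| = ‖(s j : ℂ)‖ := by simp
    rw [this, hs]
    refine (norm_sum_le _ _).trans ?_
    have : ∀ σ ∈ (Finset.univ : Finset (K →ₐ[ℚ] ℂ)), ‖(σ x) ^ j‖ ≤ 2.72 := by
      intro σ _
      rw [norm_pow]
      calc ‖σ x‖ ^ j ≤ (1 + 1 / (2 * N * p) : ℝ) ^ j := by gcongr; exact hb σ
        _ ≤ (1 + 1 / (2 * N * p) : ℝ) ^ (2 * N * p) := by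
          apply pow_le_pow_right₀ _ hj
          have : (0:ℝ) ≤ 1 / (2 * N * p) := by positivity
          linarith
        _ ≤ (Real.exp (1 / (2 * N * p))) ^ (2 * N * p) := by
          gcongr
          rw [add_comm]; exact Real.add_one_le_exp _
        _ = Real.exp 1 := by
          rw [← Real.exp_nat_mul]; congr 1; push_cast; field_simp
        _ ≤ 2.72 := by have := Real.exp_one_lt_d9; linarith
    refine (Finset.sum_le_sum this).trans ?_
    rw [Finset.sum_const, nsmul_eq_mul, Finset.card_univ]
    gcongr
  have hss : ∀ j, j ≤ 2 * N → s j = s (j * p) := by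
    intro j hj
    have h1 := powsum_congr x hx j hp (s j) (s (j * p)) (hs _) (hs _)
    have hj1 : j ≤ 2 * N * p := hj.trans (Nat.le_mul_of_pos_right _ hp.pos)
    have h2 := hsb j hj1
    have h3 := hsb (j * p) (Nat.mul_le_mul_right _ hj)
    have h4 : |((s (j * p) - s j : ℤ) : ℝ)| < p := by
      push_cast
      have : (6 * N : ℝ) < p := by exact_mod_cast hpN
      have := abs_sub (s (j*p) : ℝ) (s j)
      nlinarith
    have h5 : |s (j * p) - s j| < (p : ℤ) := by exact_mod_cast h4
    have := Int.eq_zero_of_abs_lt_dvd h1 h5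
    omega
  have hQ : ∀ Q : Polynomial ℂ, Q.natDegree ≤ 2 * N →
      ∑ σ : K →ₐ[ℚ] ℂ, Q.eval (σ x) = ∑ σ : K →ₐ[ℚ] ℂ, Q.eval ((σ x) ^ p) := by
    intro Q hQ
    simp_rw [Polynomial.eval_eq_sum_range' (Nat.lt_succ_of_le hQ)]
    rw [Finset.sum_comm, Finset.sum_comm (s := Finset.univ)]
    refine Finset.sum_congr rfl fun j hj => ?_
    rw [← Finset.mul_sum, ← Finset.mul_sum]
    simp_rw [← pow_mul, mul_comm p]
    rw [← hs, ← hs, hss j (by simpa [Nat.lt_succ_iff] using hj)]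
  -- roots map to roots
  have hmap : ∀ τ : K →ₐ[ℚ] ℂ, ∃ σ : K →ₐ[ℚ] ℂ, σ x = (τ x) ^ p := by
    intro τ
    by_contra hcon
    push Not at hcon
    set A : Finset ℂ := Finset.univ.image (fun σ : K →ₐ[ℚ] ℂ => σ x) with hA
    set B : Finset ℂ := (Finset.univ.image (fun σ : K →ₐ[ℚ] ℂ => (σ x) ^ p)).erase ((τ x) ^ p) with hB
    set Q : Polynomial ℂ := (∏ a ∈ A, (Polynomial.X - Polynomial.C a)) *
      ∏ b ∈ B, (Polynomial.X - Polynomial.C b) with hQd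
    have hdeg : Q.natDegree ≤ 2 * N := by
      refine Polynomial.natDegree_mul_le.trans ?_
      have e1 : A.card ≤ N := Finset.card_image_le.trans (by rwa [Finset.card_univ])
      have e2 : B.card ≤ N := (Finset.card_le_card (Finset.erase_subset _ _)).trans
        (Finset.card_image_le.trans (by rwa [Finset.card_univ]))
      rw [Polynomial.natDegree_finsetProd_X_sub_C_eq_card, Polynomial.natDegree_finsetProd_X_sub_C_eq_card]
      omega
    have h1 := hQ Q hdeg
    have h2 : ∑ σ : K →ₐ[ℚ] ℂ, Q.eval (σ x) = 0 := by
      refine Finset.sum_eq_zero fun σ _ => ?_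
      rw [hQd, Polynomial.eval_mul, Polynomial.eval_prod,
        Finset.prod_eq_zero (i := σ x) (by simp [hA]) (by simp), zero_mul]
    have h3 : ∀ σ : K →ₐ[ℚ] ℂ, Q.eval ((σ x) ^ p) = if (σ x) ^ p = (τ x) ^ p then Q.eval ((τ x) ^ p) else 0 := by
      intro σ
      split_ifs with h
      · rw [h]
      · rw [hQd, Polynomial.eval_mul, Polynomial.eval_prod, Polynomial.eval_prod (s := B),
          Finset.prod_eq_zero (s := B) (i := (σ x) ^ p) (by simp [hB, h]) (by simp), mul_zero]
    rw [h2, Finset.sum_congr rfl (fun σ _ => h3 σ), ← Finset.sum_filter, Finset.sum_const, nsmul_eq_mul] at h1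
    have h4 : Q.eval ((τ x) ^ p) ≠ 0 := by
      rw [hQd, Polynomial.eval_mul, Polynomial.eval_prod, Polynomial.eval_prod]
      refine mul_ne_zero (Finset.prod_ne_zero_iff.2 fun a ha => ?_) (Finset.prod_ne_zero_iff.2 fun a ha => ?_)
      · simp only [hA, Finset.mem_image, Finset.mem_univ, true_and] at ha
        obtain ⟨σ, rfl⟩ := ha
        simpa [sub_eq_zero] using (hcon σ).symm
      · have := (Finset.mem_erase.1 ha).1
        simpa [sub_eq_zero] using this.symm
    have h5 := (mul_eq_zero.1 h1.symm).resolve_right h4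
    have h6 := Finset.card_eq_zero.1 (Nat.cast_eq_zero.1 h5)
    have : τ ∈ (Finset.univ : Finset (K →ₐ[ℚ] ℂ)).filter (fun σ => (σ x) ^ p = (τ x) ^ p) := by simp
    rw [h6] at this
    simp at this
  obtain ⟨τ⟩ : Nonempty (K →ₐ[ℚ] ℂ) := by
    rw [← Fintype.card_pos_iff, AlgHom.card]; exact Module.finrank_pos
  have hit : ∀ m : ℕ, ∃ σ : K →ₐ[ℚ] ℂ, σ x = (τ x) ^ (p ^ m) := by
    intro m
    induction m with
    | zero => exact ⟨τ, by simp⟩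
    | succ m ih =>
      obtain ⟨σ, hσ⟩ := ih
      obtain ⟨σ', h'⟩ := hmap σ
      exact ⟨σ', by rw [h', hσ, ← pow_mul, pow_succ]⟩
  choose g hg using hit
  obtain ⟨a, b, hab, he⟩ := Finite.exists_ne_map_eq_of_infinite g
  have key : ∀ a b : ℕ, a < b → g a = g b → ∃ m : ℕ, 0 < m ∧ x ^ m = 1 := by
    intro a b hab he
    have h1 : (τ x) ^ (p ^ a) = (τ x) ^ (p ^ b) := by rw [← hg, ← hg, he]
    have h2 : x ^ (p ^ a) = x ^ (p ^ b) := τ.injective (by simpa using h1)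
    have hlt : p ^ a < p ^ b := Nat.pow_lt_pow_right hp.one_lt hab
    refine ⟨p ^ b - p ^ a, by omega, ?_⟩
    have h3 : x ^ (p ^ a) * x ^ (p ^ b - p ^ a) = x ^ (p ^ a) * 1 := by
      rw [← pow_add, Nat.add_sub_cancel' hlt.le, mul_one, h2]
    exact mul_left_cancel₀ (pow_ne_zero _ hx0) h3
  rcases lt_or_gt_of_ne hab with h | h
  · exact key a b h he
  · exact key b a h he.symm

lemma int_eq_sum (μ : Measure ℤ) [IsProbabilityMeasure μ]
    (hsupp : μ (({-1, 0, 1} : Set ℤ)ᶜ) = 0) (f : ℤ → ℂ) :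
    ∫ x, f x ∂μ = μ.real {-1} * f (-1) + μ.real {0} * f 0 + μ.real {1} * f 1 := by
  have h1 : μ.restrict ((({-1, 0, 1} : Finset ℤ)) : Set ℤ) = μ := by
    apply Measure.restrict_eq_self_of_ae_mem
    rw [ae_iff]
    convert hsupp using 2
    ext x; simp
  conv_lhs => rw [← h1]
  rw [setIntegral_finset]
  · simp [Finset.sum_insert]
    ring
  · exact IntegrableOn.finset

lemma sum_eq_one (μ : Measure ℤ) [IsProbabilityMeasure μ]
    (hsupp : μ (({-1, 0, 1} : Set ℤ)ᶜ) = 0) :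
    μ.real {-1} + μ.real {0} + μ.real {1} = 1 := by
  have := int_eq_sum μ hsupp (fun _ => 1)
  simp at this
  exact_mod_cast this.symm

lemma norm_pair (u v : ℝ) : ‖Complex.exp (Complex.I * u) + Complex.exp (Complex.I * v)‖ = 2 * |Real.cos ((u - v) / 2)| := by
  have : Complex.exp (Complex.I * u) + Complex.exp (Complex.I * v)
      = Complex.exp (((u + v) / 2 : ℝ) * Complex.I) * ((2 * Real.cos ((u - v) / 2) : ℝ) : ℂ) := by
    push_cast
    rw [Complex.cos, mul_div_cancel₀ _ (two_ne_zero), mul_add, ← Complex.exp_add, ← Complex.exp_add]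
    congr 2 <;> ring
  rw [this, norm_mul, Complex.norm_exp_ofReal_mul_I, Complex.norm_real]
  simp

lemma norm_comb (a b c q u v w : ℝ) (hq : 0 ≤ q) (hqa : q ≤ a) (hqb : q ≤ b) (hc : 0 ≤ c) (hs : a + b + c = 1) :
    ‖(a : ℂ) * Complex.exp (Complex.I * u) + b * Complex.exp (Complex.I * v) + c * Complex.exp (Complex.I * w)‖
      ≤ Real.exp (- q * Real.sin ((u - v) / 2) ^ 2) := by
  have e1 : ∀ r : ℝ, ‖Complex.exp (Complex.I * r)‖ = 1 := by
    intro r; rw [mul_comm]; exact Complex.norm_exp_ofReal_mul_I r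
  have e2 : (a : ℂ) * Complex.exp (Complex.I * u) + b * Complex.exp (Complex.I * v) + c * Complex.exp (Complex.I * w)
     = (q : ℂ) * (Complex.exp (Complex.I * u) + Complex.exp (Complex.I * v))
      + ((a - q : ℝ) : ℂ) * Complex.exp (Complex.I * u) + ((b - q : ℝ) : ℂ) * Complex.exp (Complex.I * v)
      + c * Complex.exp (Complex.I * w) := by push_cast; ring
  have e3 : ‖(a : ℂ) * Complex.exp (Complex.I * u) + b * Complex.exp (Complex.I * v) + c * Complex.exp (Complex.I * w)‖
      ≤ q * (2 * |Real.cos ((u - v) / 2)|) + (a - q) + (b - q) + c := by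
    rw [e2]
    refine (norm_add_le _ _).trans (add_le_add ((norm_add_le _ _).trans (add_le_add ((norm_add_le _ _).trans (add_le_add ?_ ?_)) ?_)) ?_)
    · rw [norm_mul, norm_pair, Complex.norm_real, Real.norm_of_nonneg hq]
    · rw [norm_mul, e1, Complex.norm_real, Real.norm_of_nonneg (by linarith), mul_one]
    · rw [norm_mul, e1, Complex.norm_real, Real.norm_of_nonneg (by linarith), mul_one]
    · rw [norm_mul, e1, Complex.norm_real, Real.norm_of_nonneg (by linarith), mul_one]
  refine e3.trans ?_
  have e4 := Real.add_one_le_exp (- q * Real.sin ((u - v) / 2) ^ 2)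
  refine le_trans ?_ e4
  have e5 := Real.sin_sq_add_cos_sq ((u - v) / 2)
  have e6 : |Real.cos ((u - v) / 2)| ^ 2 = Real.cos ((u - v) / 2) ^ 2 := sq_abs _
  set S := Real.sin ((u - v) / 2)
  set Cc := |Real.cos ((u - v) / 2)|
  have e7 : S ^ 2 = 1 - Cc ^ 2 := by rw [e6]; linarith
  rw [e7]
  nlinarith [mul_nonneg hq (sq_nonneg (1 - Cc))]

lemma charfn_bound (μ : Measure ℤ) [IsProbabilityMeasure μ]
    (hsupp : μ (({-1, 0, 1} : Set ℤ)ᶜ) = 0)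
    (hC : ∀ x ∈ ({-1, 0, 1} : Set ℤ), μ.real {x} < 1) :
    ∃ q : ℝ, 0 < q ∧ ∃ D : ℕ, (D = 1 ∨ D = 2) ∧ ∀ t : ℝ,
      ‖∫ x : ℤ, Complex.exp (Complex.I * ((t * x : ℝ) : ℂ)) ∂μ‖ ≤ Real.exp (- q * Real.sin (D * t / 2) ^ 2) := by
  have hs := sum_eq_one μ hsupp
  have h1 := hC (-1) (by simp)
  have h2 := hC 0 (by simp)
  have h3 := hC 1 (by simp)
  have n1 : 0 ≤ μ.real {(-1 : ℤ)} := measureReal_nonneg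
  have n2 : 0 ≤ μ.real {(0 : ℤ)} := measureReal_nonneg
  have n3 : 0 ≤ μ.real {(1 : ℤ)} := measureReal_nonneg
  simp_rw [int_eq_sum μ hsupp]
  set a := μ.real {(-1 : ℤ)}
  set b := μ.real {(0 : ℤ)}
  set c := μ.real {(1 : ℤ)}
  rcases n2.eq_or_lt with hb | hb
  · refine ⟨min a c, lt_min (by linarith) (by linarith), 2, Or.inr rfl, fun t => ?_⟩
    have := norm_comb a c b (min a c) (t * (-1)) (t * 1) (t * 0) (le_min n1 n3) (min_le_left _ _) (min_le_right _ _) n2 (by linarith)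
    convert this using 2
    · push_cast; ring
    · rw [show (t * (-1) - t * 1) / 2 = -(((2 : ℕ) : ℝ) * t / 2) by push_cast; ring, Real.sin_neg]; ring
  · by_cases ha : 0 < a
    · refine ⟨min a b, lt_min ha hb, 1, Or.inl rfl, fun t => ?_⟩
      have := norm_comb a b c (min a b) (t * (-1)) (t * 0) (t * 1) (le_min n1 n2) (min_le_left _ _) (min_le_right _ _) n3 (by linarith)
      convert this using 2
      · push_cast; ring
      · rw [show (t * (-1) - t * 0) / 2 = -(((1 : ℕ) : ℝ) * t / 2) by push_cast; ring, Real.sin_neg]; ring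
    · refine ⟨min b c, lt_min hb (by linarith), 1, Or.inl rfl, fun t => ?_⟩
      have := norm_comb b c a (min b c) (t * 0) (t * 1) (t * (-1)) (le_min n2 n3) (min_le_left _ _) (min_le_right _ _) n1 (by linarith)
      convert this using 2
      · push_cast; ring
      · rw [show (t * 0 - t * 1) / 2 = -(((1 : ℕ) : ℝ) * t / 2) by push_cast; ring, Real.sin_neg]; ring

noncomputable def sinSum (M : ℕ) (s : ℝ) : ℝ := ∑ m ∈ Finset.range M, Real.sin (m * s / 2) ^ 2

lemma sinSum_pair (M k : ℕ) (hk : k ≤ M) (s : ℝ) :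
    ((M : ℝ) - k) * Real.sin (k * s / 2) ^ 2 ≤ 4 * sinSum M s := by
  have h1 : ∀ m ∈ Finset.range (M - k), Real.sin (k * s / 2) ^ 2 ≤
      2 * Real.sin ((k + m : ℕ) * s / 2) ^ 2 + 2 * Real.sin (m * s / 2) ^ 2 := by
    intro m _
    set A := ((k + m : ℕ) : ℝ) * s / 2 with hA
    set B := (m : ℝ) * s / 2 with hB
    have : (k : ℝ) * s / 2 = A - B := by rw [hA, hB]; push_cast; ring
    rw [this, Real.sin_sub]
    have a1 := Real.sin_sq_add_cos_sq A
    have a2 := Real.sin_sq_add_cos_sq B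
    have a3 : 0 ≤ Real.sin A ^ 2 * Real.sin B ^ 2 := by positivity
    nlinarith [sq_nonneg (Real.sin A * Real.cos B + Real.cos A * Real.sin B)]
  have h2 := Finset.sum_le_sum h1
  rw [Finset.sum_const, Finset.card_range, nsmul_eq_mul, Nat.cast_sub hk, Finset.sum_add_distrib,
    ← Finset.mul_sum, ← Finset.mul_sum] at h2
  have h3 : ∑ m ∈ Finset.range (M - k), Real.sin (m * s / 2) ^ 2 ≤ sinSum M s :=
    Finset.sum_le_sum_of_subset_of_nonneg (by intro x; simp; omega) (fun _ _ _ => sq_nonneg _)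
  have h4 : ∑ m ∈ Finset.range (M - k), Real.sin ((k + m : ℕ) * s / 2) ^ 2 ≤ sinSum M s := by
    have := Finset.sum_range_add (fun m : ℕ => Real.sin (m * s / 2) ^ 2) k (M - k)
    rw [Nat.add_sub_cancel' hk] at this
    rw [sinSum, this]
    exact le_add_of_nonneg_left (Finset.sum_nonneg fun _ _ => sq_nonneg _)
  linarith

lemma sinSum_lower (M : ℕ) (hM : 2 ≤ M) (s : ℝ) (hs : |s| ≤ Real.pi) :
    (M : ℝ) / 800 ≤ sinSum M s ∨ (M : ℝ) ^ 3 / 800 * s ^ 2 ≤ sinSum M s := by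
  have hpi := Real.pi_pos
  have hpi2 : Real.pi ^ 2 ≤ 10 := by
    have := Real.pi_lt_d2; nlinarith
  have hM' : (2 : ℝ) ≤ M := by exact_mod_cast hM
  have habs : ∀ k : ℕ, Real.sin (k * s / 2) ^ 2 = Real.sin (k * |s| / 2) ^ 2 := by
    intro k
    rcases abs_cases s with h | h
    · rw [h.1]
    · rw [h.1, show (k : ℝ) * -s / 2 = -(k * s / 2) by ring, Real.sin_neg]; ring
  have hsin : ∀ k : ℕ, k * |s| ≤ Real.pi → (k * |s| / Real.pi) ^ 2 ≤ Real.sin (k * s / 2) ^ 2 := by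
    intro k hk
    rw [habs]
    have := Real.mul_le_sin (x := k * |s| / 2) (by positivity) (by linarith)
    refine pow_le_pow_left₀ (by positivity) ?_ 2
    refine le_trans (le_of_eq ?_) this
    field_simp
  by_cases h : |s| ≤ 2 * Real.pi / M
  · right
    set k := M / 2 with hk
    have k1 : (k : ℝ) ≤ M / 2 := by rw [le_div_iff₀ (by norm_num)]; exact_mod_cast Nat.div_mul_le_self M 2
    have k2 : (M : ℝ) / 3 ≤ k := by
      rw [div_le_iff₀ (by norm_num)]
      have : M ≤ k * 3 := by omega
      exact_mod_cast this
    have h1 := hsin k (by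
      calc k * |s| ≤ (M / 2) * (2 * Real.pi / M) := by gcongr
        _ = Real.pi := by field_simp)
    have h2 := sinSum_pair M k (by omega) s
    have h3 : (M : ℝ) ^ 2 / 90 * s ^ 2 ≤ (k * |s| / Real.pi) ^ 2 := by
      rw [div_pow, mul_pow, sq_abs, le_div_iff₀ (by positivity)]
      have : ((M : ℝ) / 3) ^ 2 ≤ k ^ 2 := by gcongr
      have h5 : 0 ≤ s ^ 2 := sq_nonneg _
      calc (M : ℝ) ^ 2 / 90 * s ^ 2 * Real.pi ^ 2 ≤ (M : ℝ) ^ 2 / 90 * s ^ 2 * 10 := by gcongr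
        _ = ((M : ℝ) / 3) ^ 2 * s ^ 2 := by ring
        _ ≤ _ := by gcongr
    have h6 : (M : ℝ) / 2 * ((M : ℝ) ^ 2 / 90 * s ^ 2) ≤ ((M : ℝ) - k) * Real.sin (k * s / 2) ^ 2 := by
      apply mul_le_mul (by linarith) (h3.trans h1) (by positivity) (by linarith)
    have : 0 ≤ (M:ℝ) ^ 3 * s ^ 2 := by positivity
    nlinarith
  · left
    push Not at h
    have hs0 : 0 < |s| := lt_trans (by positivity) h
    set k := ⌊Real.pi / |s|⌋₊ with hk
    have k1 : (k : ℝ) ≤ Real.pi / |s| := Nat.floor_le (by positivity)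
    have k2 : Real.pi / |s| < k + 1 := Nat.lt_floor_add_one _
    have k3 : 1 ≤ k := Nat.le_floor (by rw [Nat.cast_one, le_div_iff₀ hs0]; linarith)
    have k3' : (1 : ℝ) ≤ k := by exact_mod_cast k3
    have k4 : k * |s| ≤ Real.pi := by rwa [le_div_iff₀ hs0] at k1
    have k5 : Real.pi / 2 ≤ k * |s| := by
      rw [div_lt_iff₀ hs0] at k2; nlinarith
    have k6 : (k : ℝ) ≤ M / 2 := by
      refine k1.trans ?_
      rw [div_le_iff₀ hs0]
      rw [div_lt_iff₀ (by positivity)] at h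
      linarith
    have h1 := hsin k k4
    have h2 := sinSum_pair M k (by have : (k:ℝ) ≤ M := by linarith
                                   exact_mod_cast this) s
    have h3 : (1/4 : ℝ) ≤ (k * |s| / Real.pi) ^ 2 := by
      have : (1/2 : ℝ) ≤ k * |s| / Real.pi := by rw [le_div_iff₀ hpi]; linarith
      nlinarith
    have h6 : (M : ℝ) / 2 * (1/4) ≤ ((M : ℝ) - k) * Real.sin (k * s / 2) ^ 2 := by
      apply mul_le_mul (by linarith) (h3.trans h1) (by positivity) (by linarith)
    linarith

lemma sinSum_continuous (M : ℕ) : Continuous (sinSum M) := by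
  unfold sinSum; fun_prop

lemma sinSum_periodic (M : ℕ) (s : ℝ) : sinSum M (s + 2 * Real.pi) = sinSum M s := by
  unfold sinSum
  refine Finset.sum_congr rfl fun m _ => ?_
  rw [show (m : ℝ) * (s + 2 * Real.pi) / 2 = m * s / 2 + m * Real.pi by ring, Real.sin_add_nat_mul_pi, mul_pow]
  rw [← pow_mul, mul_comm m 2, pow_mul]; simp

lemma gauss_int (q : ℝ) (hq : 0 < q) : ∃ C : ℝ, 0 < C ∧ ∀ M : ℕ, 2 ≤ M → ∀ D : ℕ, (D = 1 ∨ D = 2) →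
    ∫ t in (0:ℝ)..(2 * Real.pi), Real.exp (- q * sinSum M (D * t)) ≤ C / Real.sqrt ((M:ℝ) ^ 3) := by
  refine ⟨2 * Real.pi * (2 * (800 / q) ^ 2) + Real.sqrt (800 * Real.pi / q), by positivity, fun M hM D hD => ?_⟩
  have hpi := Real.pi_pos
  have hM0 : (0:ℝ) < M := by positivity
  set G : ℝ → ℝ := fun s => Real.exp (- q * sinSum M s) with hG
  have hGc : Continuous G := by have := sinSum_continuous M; fun_prop
  have hGp : Function.Periodic G (2 * Real.pi) := fun s => by simp only [hG, sinSum_periodic]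
  have hGi : ∀ a b, IntervalIntegrable G volume a b := fun a b => hGc.intervalIntegrable a b
  have step1 : ∫ t in (0:ℝ)..(2 * Real.pi), Real.exp (- q * sinSum M (D * t)) = ∫ s in (-Real.pi)..Real.pi, G s := by
    have e1 : ∫ s in (-Real.pi)..Real.pi, G s = ∫ s in (0:ℝ)..(2 * Real.pi), G s := by
      have := hGp.intervalIntegral_add_eq (-Real.pi) 0
      rw [show -Real.pi + 2 * Real.pi = Real.pi by ring, zero_add] at this
      exact this
    rw [e1]
    rcases hD with rfl | rfl
    · simp [hG]
    · have e2 := intervalIntegral.integral_comp_mul_left (a := 0) (b := 2 * Real.pi) G (c := (2:ℝ)) (by norm_num)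
      have e3 := hGp.intervalIntegral_add_eq (2 * Real.pi) 0
      have e4 := intervalIntegral.integral_add_adjacent_intervals (hGi 0 (2 * Real.pi)) (hGi (2 * Real.pi) (2 * Real.pi + 2 * Real.pi))
      rw [zero_add] at e3
      rw [e3] at e4
      have : ∫ t in (0:ℝ)..(2 * Real.pi), Real.exp (- q * sinSum M ((2:ℕ) * t)) = ∫ t in (0:ℝ)..(2 * Real.pi), G (2 * t) := by
        simp [hG]
      rw [this, e2, mul_zero, show 2 * (2 * Real.pi) = 2 * Real.pi + 2 * Real.pi by ring, ← e4, smul_eq_mul]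
      ring
  rw [step1]
  set b : ℝ := q * ((M:ℝ) ^ 3 / 800) with hb
  have hb0 : 0 < b := by positivity
  have step2 : ∫ s in (-Real.pi)..Real.pi, G s ≤ ∫ s in (-Real.pi)..Real.pi, (Real.exp (-(q * (M / 800))) + Real.exp (- b * s ^ 2)) := by
    apply intervalIntegral.integral_mono_on (by linarith) (hGi _ _) (Continuous.intervalIntegrable (by fun_prop) _ _)
    intro s hs
    rcases sinSum_lower M hM s (abs_le.2 hs) with h | h
    · refine le_trans ?_ (le_add_of_nonneg_right (Real.exp_pos _).le)
      apply Real.exp_le_exp.2; nlinarith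
    · refine le_trans ?_ (le_add_of_nonneg_left (Real.exp_pos _).le)
      apply Real.exp_le_exp.2; rw [hb]; nlinarith
  refine step2.trans ?_
  rw [intervalIntegral.integral_add (by simp) (Continuous.intervalIntegrable (by fun_prop) _ _), intervalIntegral.integral_const]
  have g1 : ∫ s in (-Real.pi)..Real.pi, Real.exp (- b * s ^ 2) ≤ Real.sqrt (Real.pi / b) := by
    rw [← integral_gaussian b, intervalIntegral.integral_of_le (by linarith)]
    exact setIntegral_le_integral (integrable_exp_neg_mul_sq hb0) (ae_of_all _ fun _ => (Real.exp_pos _).le)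
  have g2 : Real.sqrt (Real.pi / b) = Real.sqrt (800 * Real.pi / q) / Real.sqrt ((M:ℝ) ^ 3) := by
    rw [← Real.sqrt_div (by positivity)]; congr 1; rw [hb]; field_simp
  have g3 : Real.exp (-(q * (M / 800))) ≤ (2 * (800 / q) ^ 2) / Real.sqrt ((M:ℝ) ^ 3) := by
    rw [Real.exp_neg, ← one_div, div_le_div_iff₀ (Real.exp_pos _) (by positivity), one_mul]
    have := Real.quadratic_le_exp_of_nonneg (x := q * (M / 800)) (by positivity)
    have h1 : Real.sqrt ((M:ℝ) ^ 3) ≤ (M:ℝ) ^ 2 := by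
      rw [Real.sqrt_le_left (by positivity), ← pow_mul]
      apply pow_le_pow_right₀ _ (by norm_num)
      exact_mod_cast (by omega : 1 ≤ M)
    refine h1.trans ?_
    calc (M:ℝ)^2 = 2 * (800 / q) ^ 2 * ((q * (M / 800)) ^ 2 / 2) := by field_simp
      _ ≤ _ := by
        gcongr
        have : 0 ≤ q * ((M:ℝ) / 800) := by positivity
        linarith
  rw [g2] at g1
  rw [smul_eq_mul, add_div]
  refine add_le_add ?_ g1
  rw [mul_div_assoc, show Real.pi - -Real.pi = 2 * Real.pi by ring]
  gcongr

lemma fourier_ineq (μ : Measure ℤ) [IsProbabilityMeasure μ] {N : ℕ} (c : Fin N → ℤ) (b : ℤ) :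
    (Measure.pi fun _ : Fin N => μ).real {a | ∑ i, c i * a i = b} ≤
      ∫ t in (0:ℝ)..(2 * Real.pi), ∏ i, ‖∫ x : ℤ, Complex.exp (Complex.I * (((c i * t) * x : ℝ) : ℂ)) ∂μ‖ := by
  set P := Measure.pi fun _ : Fin N => μ with hP
  have hpi := Real.pi_pos
  have hm : ∀ s : Set (Fin N → ℤ), MeasurableSet s := fun s => MeasurableSet.of_discrete
  -- pointwise orthogonality
  have horth : ∀ k : ℤ, ∫ t in (0:ℝ)..(2 * Real.pi), Complex.exp (Complex.I * ((t * k : ℝ) : ℂ)) =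
      if k = 0 then (2 * Real.pi : ℂ) else 0 := by
    intro k
    split_ifs with h
    · subst h; simp
    · have h1 : (Complex.I * k : ℂ) ≠ 0 := mul_ne_zero Complex.I_ne_zero (by exact_mod_cast h)
      have := integral_exp_mul_complex (a := 0) (b := 2 * Real.pi) h1
      have e : ∀ t : ℝ, Complex.exp (Complex.I * ((t * k : ℝ) : ℂ)) = Complex.exp (Complex.I * k * t) := by
        intro t; congr 1; push_cast; ring
      simp_rw [e]
      rw [this]
      have : Complex.exp (Complex.I * k * ((2 * Real.pi : ℝ) : ℂ)) = 1 := by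
        rw [Complex.exp_eq_one_iff]; exact ⟨k, by push_cast; ring⟩
      rw [this]; simp
  set X : (Fin N → ℤ) → ℤ := fun a => ∑ i, c i * a i with hX
  have h1 : (2 * Real.pi : ℂ) * (P.real {a | X a = b} : ℂ) =
      ∫ a, (∫ t in (0:ℝ)..(2 * Real.pi), Complex.exp (Complex.I * ((t * (X a - b : ℤ) : ℝ) : ℂ))) ∂P := by
    simp_rw [horth, sub_eq_zero]
    have : ∀ a, (if X a = b then (2 * Real.pi : ℂ) else 0) = Set.indicator {a | X a = b} (fun _ => (2 * Real.pi : ℂ)) a := by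
      intro a; simp [Set.indicator]
    simp_rw [this]
    rw [integral_indicator (hm _), setIntegral_const]
    simp [mul_comm]
  have h2 : ∫ a, (∫ t in (0:ℝ)..(2 * Real.pi), Complex.exp (Complex.I * ((t * (X a - b : ℤ) : ℝ) : ℂ))) ∂P =
      ∫ t in (0:ℝ)..(2 * Real.pi), (∫ a, Complex.exp (Complex.I * ((t * (X a - b : ℤ) : ℝ) : ℂ)) ∂P) := by
    simp_rw [intervalIntegral.integral_of_le (by linarith : (0:ℝ) ≤ 2 * Real.pi)]
    apply integral_integral_swap
    refine Integrable.of_bound (C := 1) ?_ ?_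
    · apply Measurable.aestronglyMeasurable
      have hXm : Measurable X := measurable_of_countable _
      have : Measurable fun z : (Fin N → ℤ) × ℝ => (((X z.1 - b : ℤ)) : ℝ) :=
        (measurable_of_countable (fun a : Fin N → ℤ => ((X a - b : ℤ) : ℝ))).comp measurable_fst
      simp only [Function.uncurry_def]
      fun_prop
    · refine ae_of_all _ fun z => ?_
      simp only [Function.uncurry_def]
      rw [mul_comm, Complex.norm_exp_ofReal_mul_I]
  have h3 : ∀ t : ℝ, ‖∫ a, Complex.exp (Complex.I * ((t * (X a - b : ℤ) : ℝ) : ℂ)) ∂P‖ =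
      ∏ i, ‖∫ x : ℤ, Complex.exp (Complex.I * (((c i * t) * x : ℝ) : ℂ)) ∂μ‖ := by
    intro t
    have e : ∀ a, Complex.exp (Complex.I * ((t * (X a - b : ℤ) : ℝ) : ℂ)) =
        Complex.exp ((-(t * b) : ℝ) * Complex.I) * ∏ i, Complex.exp (Complex.I * (((c i * t) * (a i) : ℝ) : ℂ)) := by
      intro a
      rw [← Complex.exp_sum, ← Complex.exp_add]
      congr 1
      simp only [hX]
      push_cast
      rw [← Finset.mul_sum, mul_sub, Finset.mul_sum]
      have : ∑ i, (t : ℂ) * ((c i : ℂ) * (a i)) = ∑ i, (c i : ℂ) * t * a i := 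
        Finset.sum_congr rfl fun i _ => by ring
      rw [this]; ring
    simp_rw [e]
    rw [integral_const_mul, norm_mul, Complex.norm_exp_ofReal_mul_I, one_mul, hP,
      integral_fintype_prod_eq_prod (fun i (x : ℤ) => Complex.exp (Complex.I * (((c i * t) * x : ℝ) : ℂ))), norm_prod]
  have h4 : 2 * Real.pi * P.real {a | X a = b} ≤
      ∫ t in (0:ℝ)..(2 * Real.pi), ∏ i, ‖∫ x : ℤ, Complex.exp (Complex.I * (((c i * t) * x : ℝ) : ℂ)) ∂μ‖ := by
    have e : 2 * Real.pi * P.real {a | X a = b} = ‖(2 * Real.pi : ℂ) * (P.real {a | X a = b} : ℂ)‖ := by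
      rw [norm_mul, Complex.norm_real, Real.norm_of_nonneg measureReal_nonneg]
      congr 1
      simp [abs_of_pos hpi]
    rw [e, h1, h2]
    simp_rw [← h3]
    exact intervalIntegral.norm_integral_le_integral_norm (by linarith)
  refine le_trans ?_ h4
  have : 0 ≤ P.real {a | X a = b} := measureReal_nonneg
  nlinarith [Real.pi_gt_three]

lemma small_ball (μ : Measure ℤ) [IsProbabilityMeasure μ]
    (hsupp : μ (({-1, 0, 1} : Set ℤ)ᶜ) = 0)
    (hC : ∀ x ∈ ({-1, 0, 1} : Set ℤ), μ.real {x} < 1) :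
    ∃ C : ℝ, 0 < C ∧ ∀ M : ℕ, 2 ≤ M → ∀ (N : ℕ) (e : Fin M → Fin N), Function.Injective e → ∀ b : ℤ,
      (Measure.pi fun _ : Fin N => μ).real {a | ∑ m : Fin M, (m : ℤ) * a (e m) = b} ≤ C / Real.sqrt ((M : ℝ) ^ 3) := by
  obtain ⟨q, hq, D, hD, hφ⟩ := charfn_bound μ hsupp hC
  obtain ⟨C, hC0, hC1⟩ := gauss_int q hq
  refine ⟨C, hC0, fun M hM N e he b => ?_⟩
  classical
  set c : Fin N → ℤ := fun i => ∑ m : Fin M, if e m = i then (m : ℤ) else 0 with hc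
  have hce : ∀ m, c (e m) = m := by
    intro m
    simp [hc, he.eq_iff]
  have hset : {a : Fin N → ℤ | ∑ m : Fin M, (m : ℤ) * a (e m) = b} = {a | ∑ i, c i * a i = b} := by
    ext a
    simp only [Set.mem_ofPred_eq, hc, Finset.sum_mul]
    rw [Finset.sum_comm]
    simp
  rw [hset]
  refine (fourier_ineq μ c b).trans ((?_ : _ ≤ _).trans (hC1 M hM D hD))
  have hpi := Real.pi_pos
  have hprod : ∀ t : ℝ, ∏ i, ‖∫ x : ℤ, Complex.exp (Complex.I * (((c i * t) * x : ℝ) : ℂ)) ∂μ‖ ≤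
      Real.exp (- q * sinSum M (D * t)) := by
    intro t
    calc _ ≤ ∏ i, Real.exp (- q * Real.sin (D * (c i * t) / 2) ^ 2) :=
          Finset.prod_le_prod (fun _ _ => norm_nonneg _) (fun i _ => hφ _)
      _ = Real.exp (- q * ∑ i, Real.sin (D * (c i * t) / 2) ^ 2) := by
          rw [← Real.exp_sum, Finset.mul_sum]
      _ ≤ _ := by
          apply Real.exp_le_exp.2
          have : sinSum M (D * t) ≤ ∑ i, Real.sin (D * (c i * t) / 2) ^ 2 := by
            have e1 : sinSum M (D * t) = ∑ i ∈ Finset.univ.image e, Real.sin (D * (c i * t) / 2) ^ 2 := by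
              rw [Finset.sum_image (fun _ _ _ _ h => he h), sinSum, Finset.sum_range]
              refine Finset.sum_congr rfl fun m _ => ?_
              rw [hce]; push_cast; congr 2; ring
            rw [e1]
            exact Finset.sum_le_sum_of_subset_of_nonneg (Finset.subset_univ _) fun _ _ _ => sq_nonneg _
          nlinarith
  have hcont := sinSum_continuous M
  refine intervalIntegral.integral_mono_on (by linarith) ?_ (Continuous.intervalIntegrable (by fun_prop) _ _) fun t _ => hprod t
  apply Continuous.intervalIntegrable
  refine continuous_finsetProd _ fun i _ => Continuous.norm ?_
  simp_rw [int_eq_sum μ hsupp]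
  fun_prop

lemma cond_bound {Ω α β : Type*} [MeasurableSpace Ω] (P : Measure Ω) [IsProbabilityMeasure P]
    [Countable α] [MeasurableSpace α] [MeasurableSingletonClass α] [MeasurableSpace β] [MeasurableSingletonClass β]
    (X : Ω → α) (Y : Ω → β) (hX : Measurable X) (hind : ProbabilityTheory.IndepFun X Y P)
    (E : Set Ω) (ε : ℝ) (hε : 0 ≤ ε) (hYε : ∀ y, P.real {ω | Y ω = y} ≤ ε)
    (hE : ∀ ω ∈ E, ∀ ω' ∈ E, X ω = X ω' → Y ω = Y ω') : P.real E ≤ ε := by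
  classical
  have hYε' : ∀ y, P {ω | Y ω = y} ≤ ENNReal.ofReal ε := fun y => by
    rw [← ENNReal.ofReal_toReal (measure_ne_top P _)]
    exact ENNReal.ofReal_le_ofReal (hYε y)
  have h1 : P E ≤ ∑' x : α, P (E ∩ X ⁻¹' {x}) := by
    refine (measure_mono ?_).trans (measure_iUnion_le _)
    intro ω hω
    simp [hω]
  have h2 : ∀ x : α, P (E ∩ X ⁻¹' {x}) ≤ P (X ⁻¹' {x}) * ENNReal.ofReal ε := by
    intro x
    by_cases hx : ∃ ω ∈ E, X ω = x
    · obtain ⟨ω, hω, rfl⟩ := hx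
      have : E ∩ X ⁻¹' {X ω} ⊆ X ⁻¹' {X ω} ∩ Y ⁻¹' {Y ω} := by
        rintro ω' ⟨h1, h2⟩
        exact ⟨h2, hE ω' h1 ω hω h2⟩
      refine (measure_mono this).trans ?_
      rw [hind.measure_inter_preimage_eq_mul _ _ (measurableSet_singleton _) (measurableSet_singleton _)]
      gcongr
      exact hYε' (Y ω)
    · have : E ∩ X ⁻¹' {x} = ∅ := by
        ext ω
        simp only [Set.mem_inter_iff, Set.mem_preimage, Set.mem_singleton_iff, Set.mem_empty_iff_false, iff_false]
        exact fun h => hx ⟨ω, h.1, h.2⟩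
      rw [this]; simp
  have h3 : ∑' x : α, P (X ⁻¹' {x}) = 1 := by
    rw [← measure_iUnion]
    · have : ⋃ x, X ⁻¹' {x} = Set.univ := by ext ω; simp
      rw [this]; simp
    · intro x y hxy
      exact Disjoint.preimage _ (by simpa using hxy)
    · intro x; exact hX (measurableSet_singleton _)
  have h4 : P E ≤ ENNReal.ofReal ε := by
    refine h1.trans ((ENNReal.tsum_le_tsum h2).trans ?_)
    rw [ENNReal.tsum_mul_right, h3, one_mul]
  exact ENNReal.toReal_le_of_le_ofReal hε h4

lemma indep_restrict (μ : Measure ℤ) [IsProbabilityMeasure μ] {N : ℕ} (S T : Finset (Fin N)) (h : Disjoint S T) :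
    ProbabilityTheory.IndepFun (fun (a : Fin N → ℤ) (i : S) => a i) (fun (a : Fin N → ℤ) (i : T) => a i)
      (Measure.pi fun _ : Fin N => μ) :=
  (ProbabilityTheory.iIndepFun_pi (X := fun (_ : Fin N) (x : ℤ) => x) (μ := fun _ : Fin N => μ)
    (fun _ => aemeasurable_id)).indepFun_finset S T h (fun i => measurable_pi_apply i)

lemma unique_bound (μ : Measure ℤ) [IsProbabilityMeasure μ] (p : ℝ) (hp0 : 0 ≤ p) (hp : ∀ x, μ.real {x} ≤ p)
    {N : ℕ} (T : Finset (Fin N)) (E : Set (Fin N → ℤ))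
    (hE : ∀ a ∈ E, ∀ b ∈ E, (∀ i ∉ T, a i = b i) → ∀ i ∈ T, a i = b i) :
    (Measure.pi fun _ : Fin N => μ).real E ≤ p ^ T.card := by
  refine cond_bound _ _ _ (measurable_of_countable _)
    (indep_restrict μ Tᶜ T disjoint_compl_left) E _ (by positivity) ?_ ?_
  · intro y
    classical
    have : {ω : Fin N → ℤ | (fun i : T => ω i) = y} =
        Set.univ.pi (fun i => if h : i ∈ T then {y ⟨i, h⟩} else Set.univ) := by
      ext ω
      simp only [Set.mem_ofPred_eq, funext_iff, Set.mem_univ_pi, Subtype.forall]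
      refine forall_congr' fun i => ?_
      by_cases h : i ∈ T <;> simp [h]
    rw [this, measureReal_def, Measure.pi_pi, ENNReal.toReal_prod, ← Finset.prod_const,
      ← Finset.prod_subset (Finset.subset_univ T)]
    · refine Finset.prod_le_prod (fun _ _ => by positivity) fun i hi => ?_
      simp only [hi, dif_pos]
      exact hp _
    · intro i _ hi
      simp [hi]
  · intro a ha b hb hab
    funext i
    refine hE a ha b hb (fun j hj => ?_) i i.2
    exact congrFun hab ⟨j, by simpa using hj⟩

lemma totient_aux (d : ℕ) : 0 < d → (d ≤ 2 * d.totient ^ 2 ∧ (Odd d → d ≤ d.totient ^ 2)) := by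
  induction d using Nat.recOnPosPrimePosCoprime with
  | zero => simp
  | one => simp
  | prime_pow p m hp hm =>
    intro _
    obtain ⟨m, rfl⟩ : ∃ m', m = m' + 1 := ⟨m - 1, by omega⟩
    rw [Nat.totient_prime_pow_succ hp]
    have h1 : 1 ≤ p ^ m := Nat.one_le_pow _ _ hp.pos
    rcases hp.eq_two_or_odd' with rfl | hodd
    · constructor
      · rw [pow_succ]; nlinarith
      · intro h; exact absurd h (by rw [Nat.not_odd_iff_even]; exact ⟨2 ^ m, by rw [pow_succ]; ring⟩)
    · have h3 : 3 ≤ p := by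
        have := hp.two_le
        rcases hodd with ⟨r, hr⟩; omega
      obtain ⟨r, rfl⟩ : ∃ r, p = r + 1 := ⟨p - 1, by omega⟩
      have : (r + 1) ^ (m + 1) ≤ ((r + 1) ^ m * (r + 1 - 1)) ^ 2 := by
        rw [pow_succ, mul_pow, Nat.add_sub_cancel]
        apply Nat.mul_le_mul <;> nlinarith
      exact ⟨by omega, fun _ => this⟩
  | coprime a b ha hb hab iha ihb =>
    intro _
    obtain ⟨a1, a2⟩ := iha (by omega)
    obtain ⟨b1, b2⟩ := ihb (by omega)
    rw [Nat.totient_mul hab, mul_pow]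
    constructor
    · rcases Nat.even_or_odd a with h | h
      · have hbo : Odd b := by
          rcases Nat.even_or_odd b with h' | h'
          · exfalso
            have := Nat.dvd_gcd h.two_dvd h'.two_dvd
            rw [hab] at this; omega
          · exact h'
        calc a * b ≤ (2 * a.totient ^ 2) * (b.totient ^ 2) := Nat.mul_le_mul a1 (b2 hbo)
          _ = _ := by ring
      · calc a * b ≤ (a.totient ^ 2) * (2 * b.totient ^ 2) := Nat.mul_le_mul (a2 h) b1
          _ = _ := by ring
    · intro h
      rw [Nat.odd_mul] at h
      exact Nat.mul_le_mul (a2 h.1) (b2 h.2)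

noncomputable def intPoly (n : ℕ) (a : Fin (n + 1) → ℤ) : Polynomial ℤ :=
  ∑ j : Fin (n + 1), Polynomial.C (a j) * Polynomial.X ^ (j : ℕ)

def Good (n : ℕ) (a : Fin (n + 1) → ℤ) : Prop := ∀ j, a j = -1 ∨ a j = 0 ∨ a j = 1

lemma intPoly_coeff (n : ℕ) (a : Fin (n + 1) → ℤ) (i : Fin (n + 1)) : (intPoly n a).coeff i = a i := by
  classical
  simp [intPoly, Polynomial.finsetSum_coeff, Polynomial.coeff_X_pow, Fin.val_inj]

lemma intPoly_coeff_big (n : ℕ) (a : Fin (n + 1) → ℤ) (i : ℕ) (hi : n < i) : (intPoly n a).coeff i = 0 := by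
  simp only [intPoly, Polynomial.finsetSum_coeff, Polynomial.coeff_C_mul, Polynomial.coeff_X_pow]
  refine Finset.sum_eq_zero fun j _ => ?_
  have := j.2
  rw [if_neg (by omega), mul_zero]

lemma intPoly_natDegree (n : ℕ) (a : Fin (n + 1) → ℤ) : (intPoly n a).natDegree ≤ n :=
  Polynomial.natDegree_le_iff_coeff_eq_zero.2 (fun i hi => intPoly_coeff_big n a i hi)

lemma intPoly_map (n : ℕ) (a : Fin (n + 1) → ℤ) : (intPoly n a).map (Int.castRingHom ℂ) = polyOf n a := by
  simp [intPoly, polyOf, Polynomial.map_sum]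

lemma intPoly_coeff_good (n : ℕ) (a : Fin (n + 1) → ℤ) (h : Good n a) (i : ℕ) :
    (intPoly n a).coeff i = -1 ∨ (intPoly n a).coeff i = 0 ∨ (intPoly n a).coeff i = 1 := by
  by_cases hi : i < n + 1
  · have := intPoly_coeff n a ⟨i, hi⟩
    simp only at this
    rw [this]; exact h _
  · rw [intPoly_coeff_big n a i (by omega)]; simp

lemma aeval_intPoly (n : ℕ) (a : Fin (n + 1) → ℤ) (z : ℂ) :
    Polynomial.aeval z (intPoly n a) = ∑ i : Fin (n + 1), (a i : ℂ) * z ^ (i : ℕ) := by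
  simp [intPoly]

lemma double_iff (n : ℕ) (a : Fin (n + 1) → ℤ) (z : ℂ) : isDoubleRootAt n a z ↔
    Polynomial.aeval z (intPoly n a) = 0 ∧ Polynomial.aeval z (Polynomial.derivative (intPoly n a)) = 0 := by
  unfold isDoubleRootAt
  rw [← intPoly_map, Polynomial.derivative_map]
  simp [Polynomial.aeval_def, Polynomial.eval_map]

lemma root_bound (R : Polynomial ℤ) (hR : R ≠ 0) (B : ℕ) (hB : ∀ i, |R.coeff i| ≤ B) (w : ℂ)
    (hw : Polynomial.aeval w R = 0) : ‖w‖ < B + 1 := by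
  have hinj : Function.Injective (Int.castRingHom ℂ) := Int.cast_injective
  have hR' : R.map (Int.castRingHom ℂ) ≠ 0 := by
    rwa [Ne, Polynomial.map_eq_zero_iff hinj]
  have hroot : (R.map (Int.castRingHom ℂ)).IsRoot w := by
    rw [Polynomial.IsRoot, Polynomial.eval_map]
    simpa [Polynomial.aeval_def] using hw
  have h1 := hroot.norm_lt_cauchyBound hR'
  refine lt_of_lt_of_le h1 ?_
  unfold Polynomial.cauchyBound
  rw [Polynomial.leadingCoeff_map_of_injective hinj]
  have h2 : Finset.sup (Finset.range (R.map (Int.castRingHom ℂ)).natDegree) (fun i => ‖(R.map (Int.castRingHom ℂ)).coeff i‖₊) ≤ (B : NNReal) := by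
    refine Finset.sup_le fun i _ => ?_
    rw [← NNReal.coe_le_coe]
    simp only [Polynomial.coeff_map, coe_nnnorm, eq_intCast, Complex.norm_intCast]
    have := hB i
    have h' : ((|R.coeff i| : ℤ) : ℝ) ≤ ((B : ℤ) : ℝ) := Int.cast_le.2 this
    simpa using h'
  have h3 : (1 : NNReal) ≤ ‖(Int.castRingHom ℂ) R.leadingCoeff‖₊ := by
    rw [← NNReal.coe_le_coe]
    simp only [coe_nnnorm, eq_intCast, Complex.norm_intCast, NNReal.coe_one]
    have := Int.one_le_abs (Polynomial.leadingCoeff_ne_zero.2 hR)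
    exact_mod_cast this
  have h4 : Finset.sup (Finset.range (R.map (Int.castRingHom ℂ)).natDegree) (fun i => ‖(R.map (Int.castRingHom ℂ)).coeff i‖₊) / ‖(Int.castRingHom ℂ) R.leadingCoeff‖₊ ≤ (B : NNReal) :=
    (div_le_self (zero_le) h3).trans h2
  have h5 := add_le_add_left h4 1
  exact_mod_cast h5

lemma good_integral (n : ℕ) (a : Fin (n + 1) → ℤ) (h : Good n a) (h0 : intPoly n a ≠ 0) (z : ℂ)
    (hz : Polynomial.aeval z (intPoly n a) = 0) : IsIntegral ℤ z := by
  rcases intPoly_coeff_good n a h (intPoly n a).natDegree with h1 | h1 | h1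
  · refine ⟨-intPoly n a, ?_, ?_⟩
    · rw [Polynomial.Monic, Polynomial.leadingCoeff_neg, Polynomial.leadingCoeff, h1]; rfl
    · rw [← Polynomial.aeval_def, map_neg, hz, neg_zero]
  · exact absurd h1 (Polynomial.leadingCoeff_ne_zero.2 h0)
  · exact ⟨intPoly n a, h1, by rw [← Polynomial.aeval_def, hz]⟩

lemma minpoly_sq_dvd (P : Polynomial ℤ) (z : ℂ) (hz : IsIntegral ℤ z) (h0 : Polynomial.aeval z P = 0)
    (h1 : Polynomial.aeval z (Polynomial.derivative P) = 0) : (minpoly ℤ z) ^ 2 ∣ P := by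
  obtain ⟨g, hg⟩ := minpoly.isIntegrallyClosed_dvd hz h0
  have hf' : Polynomial.aeval z (Polynomial.derivative (minpoly ℤ z)) ≠ 0 := by
    intro h
    have hd := minpoly.isIntegrallyClosed_dvd hz h
    have hpos := minpoly.natDegree_pos hz
    have hne : Polynomial.derivative (minpoly ℤ z) ≠ 0 := by
      intro h'
      have := Polynomial.derivative_eq_zero.1 h'
      omega
    have := Polynomial.natDegree_le_of_dvd hd hne
    have := Polynomial.natDegree_derivative_lt (p := minpoly ℤ z) (by omega)
    omega
  rw [hg, Polynomial.derivative_mul, map_add, map_mul, map_mul, minpoly.aeval, zero_mul, add_zero] at h1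
  have hgz := (mul_eq_zero.1 h1).resolve_left hf'
  obtain ⟨g', hg'⟩ := minpoly.isIntegrallyClosed_dvd hz hgz
  exact ⟨g', by rw [hg, hg']; ring⟩

lemma trichotomy (P : Polynomial ℤ) (z : ℂ) (hz : IsIntegral ℤ z) (hz0 : z ≠ 0)
    (h0 : Polynomial.aeval z P = 0) (N : ℕ) (hN : 1 ≤ N) (hdeg : (minpoly ℤ z).natDegree ≤ N) :
    (∃ w : ℂ, IsIntegral ℤ w ∧ Polynomial.aeval w P = 0 ∧ 1 + 1 / (24 * (N:ℝ) ^ 2) ≤ ‖w‖ ∧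
      (minpoly ℤ w).natDegree ≤ N) ∨ (∃ d, 0 < d ∧ d ≤ 2 * N ^ 2 ∧ IsPrimitiveRoot z d) := by
  have hzQ : IsIntegral ℚ z := hz.tower_top
  obtain ⟨p, hp, hp1, hp2⟩ := Nat.exists_prime_lt_and_le_two_mul (6 * N) (by omega)
  have : FiniteDimensional ℚ (IntermediateField.adjoin ℚ {z}) := IntermediateField.adjoin.finiteDimensional hzQ
  have : NumberField (IntermediateField.adjoin ℚ {z}) := { to_charZero := inferInstance, to_finiteDimensional := this }
  set x := IntermediateField.AdjoinSimple.gen ℚ z with hx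
  have hxz : algebraMap _ ℂ x = z := IntermediateField.AdjoinSimple.algebraMap_gen ℚ z
  have hinj : Function.Injective (algebraMap (IntermediateField.adjoin ℚ {z}) ℂ) := FaithfulSMul.algebraMap_injective _ _
  let ι : (IntermediateField.adjoin ℚ {z}) →ₐ[ℤ] ℂ := (IsScalarTower.toAlgHom ℚ (IntermediateField.adjoin ℚ {z}) ℂ).restrictScalars ℤ
  have hι : Function.Injective ι := hinj
  have hιx : ι x = z := hxz
  have hxi : IsIntegral ℤ x := by
    rw [← isIntegral_algHom_iff ι hι, hιx]; exact hz
  have hx0 : x ≠ 0 := by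
    rintro h; rw [h, map_zero] at hιx; exact hz0 hιx.symm
  have hfin : Module.finrank ℚ (IntermediateField.adjoin ℚ {z}) ≤ N := by
    rw [IntermediateField.adjoin.finrank hzQ, minpoly.isIntegrallyClosed_eq_field_fractions' ℚ hz,
      (minpoly.monic hz).natDegree_map]
    exact hdeg
  have hp0 : (0:ℝ) < p := by exact_mod_cast hp.pos
  have hN0 : (0:ℝ) < N := by exact_mod_cast hN
  have hpx : Polynomial.aeval x P = 0 := by
    apply hι
    rw [← Polynomial.aeval_algHom_apply, hιx, h0, map_zero]
  by_cases hb : ∀ σ : (IntermediateField.adjoin ℚ {z}) →ₐ[ℚ] ℂ, ‖σ x‖ ≤ 1 + 1 / (2 * N * p)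
  · right
    obtain ⟨m, hm, hm1⟩ := dobrowolski x hxi hx0 N hN hfin hp hp1 hb
    have hzm : z ^ m = 1 := by rw [← hιx, ← map_pow, hm1, map_one]
    have hfo : IsOfFinOrder z := isOfFinOrder_iff_pow_eq_one.2 ⟨m, hm, hzm⟩
    refine ⟨orderOf z, hfo.orderOf_pos, ?_, IsPrimitiveRoot.orderOf z⟩
    have h1 := (totient_aux (orderOf z) hfo.orderOf_pos).1
    have h2 := (IsPrimitiveRoot.orderOf z).totient_le_degree_minpoly
    have h3 : (orderOf z).totient ≤ N := h2.trans hdeg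
    calc orderOf z ≤ 2 * (orderOf z).totient ^ 2 := h1
      _ ≤ 2 * N ^ 2 := by gcongr
  · left
    push Not at hb
    obtain ⟨σ, hσ⟩ := hb
    let τ : (IntermediateField.adjoin ℚ {z}) →ₐ[ℤ] ℂ := σ.restrictScalars ℤ
    have hτ : Function.Injective τ := σ.injective
    have hτx : τ x = σ x := rfl
    refine ⟨σ x, ?_, ?_, ?_, ?_⟩
    · rw [← hτx]; exact hxi.map τ
    · rw [← hτx, Polynomial.aeval_algHom_apply, hpx, map_zero]
    · refine le_trans ?_ hσ.le
      refine add_le_add_right (one_div_le_one_div_of_le (by positivity) ?_) 1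
      have : (p : ℝ) ≤ 12 * N := by
        have : p ≤ 12 * N := by omega
        exact_mod_cast this
      nlinarith
    · rw [← hτx, minpoly.algHom_eq τ hτ, ← minpoly.algHom_eq ι hι, hιx]; exact hdeg

lemma caseA_one (μ : Measure ℤ) [IsProbabilityMeasure μ] (p : ℝ) (hp0 : 0 ≤ p) (hp : ∀ x, μ.real {x} ≤ p)
    (n k : ℕ) (hk : 2 * k ≤ n + 1) (q : Polynomial (ZMod 3)) (hq : q.Monic) (hqk : q.natDegree = k) :
    (Measure.pi fun _ : Fin (n + 1) => μ).real
      {a | Good n a ∧ q ^ 2 ∣ (intPoly n a).map (Int.castRingHom (ZMod 3))} ≤ p ^ (2 * k) := by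
  classical
  set T : Finset (Fin (n + 1)) := Finset.univ.filter (fun i => (i : ℕ) < 2 * k) with hT
  have hcard : T.card = 2 * k := by
    rw [hT, Fin.card_filter_val_lt]; exact min_eq_right hk
  rw [← hcard]
  apply unique_bound μ p hp0 hp
  rintro a ⟨ha, hda⟩ b ⟨hb, hdb⟩ hab i hi
  have hd := dvd_sub hda hdb
  set R := (intPoly n a).map (Int.castRingHom (ZMod 3)) - (intPoly n b).map (Int.castRingHom (ZMod 3)) with hR
  have hR0 : R = 0 := by
    by_contra hne
    have h1 := Polynomial.natDegree_le_of_dvd hd hne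
    rw [hq.natDegree_pow, hqk] at h1
    have h2 : R.coeff R.natDegree ≠ 0 := Polynomial.leadingCoeff_ne_zero.2 hne
    apply h2
    rw [hR, Polynomial.coeff_sub, Polynomial.coeff_map, Polynomial.coeff_map, ← hR]
    by_cases hlt : R.natDegree < n + 1
    · have e1 := intPoly_coeff n a ⟨_, hlt⟩
      have e2 := intPoly_coeff n b ⟨_, hlt⟩
      simp only at e1 e2
      rw [e1, e2, hab ⟨_, hlt⟩ (by simp [hT]; omega), sub_self]
    · rw [intPoly_coeff_big n a _ (by omega), intPoly_coeff_big n b _ (by omega), sub_self]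
  have h3 : R.coeff i = 0 := by rw [hR0]; simp
  rw [hR, Polynomial.coeff_sub, Polynomial.coeff_map, Polynomial.coeff_map, intPoly_coeff, intPoly_coeff] at h3
  rcases ha i with h | h | h <;> rcases hb i with h' | h' | h' <;> rw [h, h'] at h3 ⊢ <;> revert h3 <;> decide

lemma caseA (μ : Measure ℤ) [IsProbabilityMeasure μ] (p : ℝ) (hp0 : 0 ≤ p) (hp3 : 3 * p ^ 2 ≤ 1) (hp : ∀ x, μ.real {x} ≤ p)
    (n N : ℕ) :
    (Measure.pi fun _ : Fin (n + 1) => μ).real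
      {a | Good n a ∧ intPoly n a ≠ 0 ∧ ∃ f : Polynomial ℤ, f.Monic ∧ N < f.natDegree ∧ f ^ 2 ∣ intPoly n a}
      ≤ n * (3 * p ^ 2) ^ N := by
  classical
  set P := (Measure.pi fun _ : Fin (n + 1) => μ) with hP
  have : IsProbabilityMeasure P := by rw [hP]; infer_instance
  let Q : (k : ℕ) → (Fin k → ZMod 3) → Polynomial (ZMod 3) := fun k c =>
    Polynomial.X ^ k + ∑ i : Fin k, Polynomial.C (c i) * Polynomial.X ^ (i : ℕ)
  have hQ : ∀ k c, (Q k c).Monic ∧ (Q k c).natDegree = k := by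
    intro k c
    have hd : Polynomial.degree (∑ i : Fin k, Polynomial.C (c i) * Polynomial.X ^ (i : ℕ)) < (k : WithBot ℕ) := by
      refine lt_of_le_of_lt (Polynomial.degree_sum_le _ _) ?_
      refine (Finset.sup_lt_iff (WithBot.bot_lt_coe k)).2 ?_
      intro i _
      refine lt_of_le_of_lt (Polynomial.degree_C_mul_X_pow_le _ _) ?_
      exact WithBot.coe_lt_coe.2 i.2
    refine ⟨Polynomial.monic_X_pow_add hd, ?_⟩
    have := Polynomial.degree_add_eq_left_of_degree_lt (p := (Polynomial.X ^ k : Polynomial (ZMod 3)))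
      (q := ∑ i : Fin k, Polynomial.C (c i) * Polynomial.X ^ (i : ℕ)) (by rwa [Polynomial.degree_X_pow])
    rw [Polynomial.degree_X_pow] at this
    exact Polynomial.natDegree_eq_of_degree_eq_some this
  let S := (Finset.Ioc N n).filter (fun k => 2 * k ≤ n + 1)
  have hsub : {a | Good n a ∧ intPoly n a ≠ 0 ∧ ∃ f : Polynomial ℤ, f.Monic ∧ N < f.natDegree ∧ f ^ 2 ∣ intPoly n a} ⊆
      ⋃ k ∈ S, ⋃ c ∈ (Finset.univ : Finset (Fin k → ZMod 3)),
        {a | Good n a ∧ (Q k c) ^ 2 ∣ (intPoly n a).map (Int.castRingHom (ZMod 3))} := by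
    rintro a ⟨ha, h0, f, hf, hfN, hfd⟩
    have hdeg := (Polynomial.natDegree_le_of_dvd hfd h0).trans (intPoly_natDegree n a)
    rw [hf.natDegree_pow] at hdeg
    simp only [Set.mem_iUnion]
    refine ⟨f.natDegree, by simp [S]; omega, fun i => ((f.coeff i : ℤ) : ZMod 3), Finset.mem_univ _, ha, ?_⟩
    have : Q f.natDegree (fun i => ((f.coeff i : ℤ) : ZMod 3)) = f.map (Int.castRingHom (ZMod 3)) := by
      conv_rhs => rw [hf.as_sum]
      simp [Q, Polynomial.map_sum, Finset.sum_range]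
    rw [this, ← Polynomial.map_pow]
    exact Polynomial.map_dvd _ hfd
  refine (measureReal_mono hsub (measure_ne_top _ _)).trans ((measureReal_biUnion_finset_le _ _).trans ?_)
  have hterm : ∀ k ∈ S, P.real (⋃ c ∈ (Finset.univ : Finset (Fin k → ZMod 3)),
        {a | Good n a ∧ (Q k c) ^ 2 ∣ (intPoly n a).map (Int.castRingHom (ZMod 3))}) ≤ (3 * p ^ 2) ^ N := by
    intro k hk
    simp only [S, Finset.mem_filter, Finset.mem_Ioc] at hk
    refine (measureReal_biUnion_finset_le _ _).trans ?_
    refine (Finset.sum_le_sum fun c _ => caseA_one μ p hp0 hp n k hk.2 (Q k c) (hQ k c).1 (hQ k c).2).trans ?_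
    rw [Finset.sum_const, Finset.card_univ, Fintype.card_fun, Fintype.card_fin, ZMod.card, nsmul_eq_mul]
    push_cast
    rw [pow_mul, ← mul_pow]
    exact pow_le_pow_of_le_one (by positivity) hp3 (by omega)
  refine (Finset.sum_le_sum hterm).trans ?_
  rw [Finset.sum_const, nsmul_eq_mul]
  gcongr
  refine (Finset.card_filter_le _ _).trans ?_
  simp

lemma caseB_one (μ : Measure ℤ) [IsProbabilityMeasure μ] (p : ℝ) (hp0 : 0 ≤ p) (hp1 : p ≤ 1) (hp : ∀ x, μ.real {x} ≤ p)
    (n s : ℕ) (hs : 0 < s) (w : ℂ) (hw : 3 ≤ ‖w‖ ^ s) :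
    (Measure.pi fun _ : Fin (n + 1) => μ).real
      {a | Good n a ∧ Polynomial.aeval w (intPoly n a) = 0} ≤ p ^ (n / s) := by
  classical
  set T : Finset (Fin (n + 1)) := Finset.univ.filter (fun i => s ∣ (i : ℕ)) with hT
  have hcard : n / s ≤ T.card := by
    have : (Finset.univ : Finset (Fin (n / s))).card ≤ T.card := by
      refine Finset.card_le_card_of_injOn (fun j => ⟨s * j, ?_⟩) ?_ ?_
      · have := j.2
        have h1 : s * j ≤ s * (n / s) := Nat.mul_le_mul_left _ (by omega)
        have h2 := Nat.mul_div_le n s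
        omega
      · intro j _; simp [hT]
      · intro i _ j _ h
        simp only [Fin.mk.injEq] at h
        exact Fin.ext (Nat.eq_of_mul_eq_mul_left hs h)
    simpa using this
  refine le_trans ?_ (pow_le_pow_of_le_one hp0 hp1 hcard)
  apply unique_bound μ p hp0 hp
  rintro a ⟨ha, hwa⟩ b ⟨hb, hwb⟩ hab i hi
  set R := intPoly n a - intPoly n b with hR
  have hRw : Polynomial.aeval w R = 0 := by rw [hR, map_sub, hwa, hwb, sub_zero]
  have hRc : ∀ j, |R.coeff j| ≤ (2 : ℕ) := by
    intro j
    rw [hR, Polynomial.coeff_sub]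
    rcases intPoly_coeff_good n a ha j with h | h | h <;> rcases intPoly_coeff_good n b hb j with h' | h' | h' <;>
      rw [h, h'] <;> decide
  have hRs : ∀ j, ¬ s ∣ j → R.coeff j = 0 := by
    intro j hj
    rw [hR, Polynomial.coeff_sub]
    by_cases hlt : j < n + 1
    · have e1 := intPoly_coeff n a ⟨_, hlt⟩
      have e2 := intPoly_coeff n b ⟨_, hlt⟩
      simp only at e1 e2
      rw [e1, e2, hab ⟨_, hlt⟩ (by simpa [hT] using hj), sub_self]
    · rw [intPoly_coeff_big n a _ (by omega), intPoly_coeff_big n b _ (by omega), sub_self]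
  set Q := Polynomial.contract s R with hQ
  have hexp : Polynomial.expand ℤ s Q = R := by
    ext j
    rw [Polynomial.coeff_expand hs]
    split_ifs with h
    · rw [hQ, Polynomial.coeff_contract hs.ne', Nat.div_mul_cancel h]
    · exact (hRs j h).symm
  have hQ0 : Q = 0 := by
    by_contra hne
    have := root_bound Q hne 2 (fun j => by rw [hQ, Polynomial.coeff_contract hs.ne']; exact hRc _) (w ^ s) (by
      rw [← hexp, Polynomial.expand_aeval] at hRw; exact hRw)
    rw [norm_pow] at this
    norm_num at this
    linarith
  have hR0 : R = 0 := by rw [← hexp, hQ0, map_zero]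
  have h3 : R.coeff i = 0 := by rw [hR0]; simp
  rw [hR, Polynomial.coeff_sub, intPoly_coeff, intPoly_coeff] at h3
  linarith

lemma caseB (μ : Measure ℤ) [IsProbabilityMeasure μ] (p : ℝ) (hp0 : 0 ≤ p) (hp1 : p ≤ 1) (hp : ∀ x, μ.real {x} ≤ p)
    (n N : ℕ) (hN : 1 ≤ N) :
    (Measure.pi fun _ : Fin (n + 1) => μ).real
      {a | Good n a ∧ intPoly n a ≠ 0 ∧ ∃ w : ℂ, IsIntegral ℤ w ∧ Polynomial.aeval w (intPoly n a) = 0 ∧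
        1 + 1 / (24 * (N:ℝ) ^ 2) ≤ ‖w‖ ∧ (minpoly ℤ w).natDegree ≤ N}
      ≤ (2 * 4 ^ N + 1 : ℝ) ^ (N + 1) * p ^ (n / (48 * N ^ 2)) := by
  classical
  set P := (Measure.pi fun _ : Fin (n + 1) => μ) with hP
  have : IsProbabilityMeasure P := by rw [hP]; infer_instance
  have hN0 : (0:ℝ) < N := by exact_mod_cast hN
  let I : Finset ℤ := Finset.Icc (-(4 ^ N)) (4 ^ N)
  let F : Finset (Fin (N + 1) → ℤ) := Fintype.piFinset (fun _ => I)
  let Ev : (Fin (N + 1) → ℤ) → Set (Fin (n + 1) → ℤ) := fun c =>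
    {a | Good n a ∧ ∃ w : ℂ, IsIntegral ℤ w ∧ Polynomial.aeval w (intPoly n a) = 0 ∧
        1 + 1 / (24 * (N:ℝ) ^ 2) ≤ ‖w‖ ∧ (minpoly ℤ w) = intPoly N c}
  have hsub : {a | Good n a ∧ intPoly n a ≠ 0 ∧ ∃ w : ℂ, IsIntegral ℤ w ∧ Polynomial.aeval w (intPoly n a) = 0 ∧
        1 + 1 / (24 * (N:ℝ) ^ 2) ≤ ‖w‖ ∧ (minpoly ℤ w).natDegree ≤ N} ⊆ ⋃ c ∈ F, Ev c := by
    rintro a ⟨ha, h0, w, hw, hwa, hwn, hdeg⟩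
    simp only [Set.mem_iUnion]
    refine ⟨fun i => (minpoly ℤ w).coeff i, ?_, ha, w, hw, hwa, hwn, ?_⟩
    · rw [Fintype.mem_piFinset]
      intro i
      have hb := Polynomial.coeff_bdd_of_roots_le (B := 2) (d := N) (Int.castRingHom ℂ) (minpoly.monic hw)
        (IsAlgClosed.splits _) hdeg (by
          intro z hz
          have hfz : Polynomial.aeval z (minpoly ℤ w) = 0 := by
            have := (Polynomial.mem_roots'.1 hz).2
            rw [Polynomial.IsRoot, Polynomial.eval_map] at this
            simpa [Polynomial.aeval_def] using this
          obtain ⟨g, hg⟩ := minpoly.isIntegrallyClosed_dvd hw hwa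
          have hz0 : Polynomial.aeval z (intPoly n a) = 0 := by rw [hg, map_mul, hfz, zero_mul]
          have := root_bound (intPoly n a) h0 1 (fun j => by
            rcases intPoly_coeff_good n a ha j with h | h | h <;> rw [h] <;> decide) z hz0
          norm_num at this
          exact this.le) i
      have h1 : (|((minpoly ℤ w).coeff i : ℝ)|) ≤ 4 ^ N := by
        rw [Polynomial.coeff_map, eq_intCast, Complex.norm_intCast] at hb
        refine hb.trans ?_
        have : ((N.choose (N / 2) : ℕ) : ℝ) ≤ 2 ^ N := by exact_mod_cast Nat.choose_le_two_pow N (N / 2)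
        calc max (2:ℝ) 1 ^ N * (N.choose (N / 2)) ≤ 2 ^ N * 2 ^ N := by
              rw [max_eq_left (by norm_num)]; gcongr
          _ = 4 ^ N := by rw [← mul_pow]; norm_num
      have h2 : |(minpoly ℤ w).coeff i| ≤ 4 ^ N := by exact_mod_cast h1
      simp only [I, Finset.mem_Icc]
      exact abs_le.1 h2
    · ext j
      by_cases hj : j < N + 1
      · have := intPoly_coeff N (fun i => (minpoly ℤ w).coeff i) ⟨j, hj⟩
        simp only at this
        rw [this]
      · rw [intPoly_coeff_big _ _ _ (by omega), Polynomial.coeff_eq_zero_of_natDegree_lt (by omega)]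
  refine (measureReal_mono hsub (measure_ne_top _ _)).trans ((measureReal_biUnion_finset_le _ _).trans ?_)
  have hterm : ∀ c ∈ F, P.real (Ev c) ≤ p ^ (n / (48 * N ^ 2)) := by
    intro c _
    by_cases hex : ∃ w : ℂ, IsIntegral ℤ w ∧ 1 + 1 / (24 * (N:ℝ) ^ 2) ≤ ‖w‖ ∧ (minpoly ℤ w) = intPoly N c
    · obtain ⟨w, hw, hwn, hwc⟩ := hex
      refine le_trans (measureReal_mono ?_) (caseB_one μ p hp0 hp1 hp n (48 * N ^ 2) (by positivity) w ?_)
      · rintro a ⟨ha, w', hw', hwa', _, hc'⟩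
        refine ⟨ha, ?_⟩
        obtain ⟨g, hg⟩ := minpoly.isIntegrallyClosed_dvd hw' hwa'
        rw [hg, hc', ← hwc, map_mul, minpoly.aeval, zero_mul]
      · have h1 := one_add_mul_le_pow (a := 1 / (24 * (N:ℝ) ^ 2)) (le_trans (by norm_num) (by positivity : (0:ℝ) ≤ 1 / (24 * (N:ℝ) ^ 2))) (48 * N ^ 2)
        have h2 : (1 + 1 / (24 * (N:ℝ) ^ 2)) ^ (48 * N ^ 2) ≤ ‖w‖ ^ (48 * N ^ 2) := by gcongr
        refine le_trans (le_of_eq ?_) (h1.trans h2)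
        push_cast; field_simp; norm_num
    · have : Ev c = ∅ := by
        ext a
        simp only [Ev, Set.mem_ofPred_eq, Set.mem_empty_iff_false, iff_false]
        rintro ⟨_, w, h1, _, h2, h3⟩
        exact hex ⟨w, h1, h2, h3⟩
      rw [this]; simp; positivity
  refine (Finset.sum_le_sum hterm).trans ?_
  rw [Finset.sum_const, nsmul_eq_mul]
  gcongr
  have : F.card = (2 * 4 ^ N + 1) ^ (N + 1) := by
    simp only [F, Fintype.card_piFinset, Finset.prod_const, Finset.card_univ, Fintype.card_fin, I, Int.card_Icc]
    congr 1
    have : (4 ^ N + 1 - -(4 ^ N) : ℤ) = ((2 * 4 ^ N + 1 : ℕ) : ℤ) := by push_cast; ring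
    rw [this, Int.toNat_natCast]
  rw [this]; push_cast; rfl

lemma aeval_deriv_intPoly (n : ℕ) (a : Fin (n + 1) → ℤ) (z : ℂ) :
    z * Polynomial.aeval z (Polynomial.derivative (intPoly n a)) =
      ∑ i : Fin (n + 1), ((i : ℕ) : ℂ) * (a i : ℂ) * z ^ (i : ℕ) := by
  simp only [intPoly, map_sum, Finset.mul_sum]
  refine Finset.sum_congr rfl fun i _ => ?_
  rw [Polynomial.derivative_C_mul_X_pow]
  rcases Nat.eq_zero_or_pos (i : ℕ) with h | h
  · simp [h]
  · obtain ⟨k, hk⟩ : ∃ k, (i : ℕ) = k + 1 := ⟨i - 1, by omega⟩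
    rw [hk]; simp; ring

lemma prim_indep (z : ℂ) (d : ℕ) (hd : 3 ≤ d) (hz : IsPrimitiveRoot z d) (u v : ℤ) (h : (u : ℂ) + v * z = 0) :
    u = 0 ∧ v = 0 := by
  have hv : v = 0 := by
    by_contra hv
    have hvR : (v : ℝ) ≠ 0 := by exact_mod_cast hv
    have hvC : (v : ℂ) ≠ 0 := by exact_mod_cast hv
    have hzr : z = ((-(u:ℝ) / v : ℝ) : ℂ) := by
      push_cast
      field_simp
      linear_combination h
    have hn : ‖z‖ = 1 := hz.norm'_eq_one (by omega)
    rw [hzr, Complex.norm_real, Real.norm_eq_abs] at hn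
    have hsq : z ^ 2 = 1 := by
      rw [hzr, ← Complex.ofReal_pow, ← sq_abs, hn]; simp
    have := Nat.le_of_dvd (by norm_num) (hz.dvd_of_pow_eq_one 2 hsq)
    omega
  subst hv
  simp at h
  exact ⟨h, rfl⟩

lemma sum_split {N M : ℕ} (e0 e1 : Fin M → Fin N) (h0 : Function.Injective e0) (h1 : Function.Injective e1)
    (hdis : ∀ i j, e0 i ≠ e1 j) (g : Fin N → ℂ) (hg : ∀ i, (∀ m, e0 m ≠ i) → (∀ m, e1 m ≠ i) → g i = 0) :
    ∑ i, g i = ∑ m, g (e0 m) + ∑ m, g (e1 m) := by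
  classical
  rw [← Finset.sum_image (f := g) (s := Finset.univ) (g := e0) (fun _ _ _ _ h => h0 h),
    ← Finset.sum_image (f := g) (s := Finset.univ) (g := e1) (fun _ _ _ _ h => h1 h),
    ← Finset.sum_union]
  · symm
    apply Finset.sum_subset (Finset.subset_univ _)
    intro i _ hi
    simp only [Finset.mem_union, Finset.mem_image, Finset.mem_univ, true_and, not_or, not_exists] at hi
    exact hg i hi.1 hi.2
  · rw [Finset.disjoint_left]
    intro i hi hi'
    simp only [Finset.mem_image, Finset.mem_univ, true_and] at hi hi'
    obtain ⟨x, rfl⟩ := hi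
    obtain ⟨y, hy⟩ := hi'
    exact hdis x y hy.symm

lemma caseC_one (μ : Measure ℤ) [IsProbabilityMeasure μ] (C : ℝ) (hC0 : 0 < C) (n M d : ℕ)
    (hsb : ∀ (e : Fin M → Fin (n + 1)), Function.Injective e → ∀ b : ℤ,
      (Measure.pi fun _ : Fin (n + 1) => μ).real {a | ∑ m : Fin M, (m : ℤ) * a (e m) = b} ≤ C / Real.sqrt ((M : ℝ) ^ 3))
    (hd : 3 ≤ d) (hdM : d * M ≤ n + 1) (z : ℂ) (hz : IsPrimitiveRoot z d) :
    (Measure.pi fun _ : Fin (n + 1) => μ).real {a | isDoubleRootAt n a z} ≤ C ^ 2 / (M : ℝ) ^ 3 := by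
  classical
  have hlt : ∀ m : Fin M, d * (m : ℕ) + d ≤ n + 1 := fun m => by
    have : d * ((m : ℕ) + 1) ≤ d * M := Nat.mul_le_mul_left _ m.2
    rw [mul_add, mul_one] at this; omega
  let e0 : Fin M → Fin (n + 1) := fun m => ⟨d * m, by have := hlt m; omega⟩
  let e1 : Fin M → Fin (n + 1) := fun m => ⟨d * m + 1, by have := hlt m; omega⟩
  have h0 : Function.Injective e0 := by
    intro i j h
    simp only [e0, Fin.mk.injEq] at h
    exact Fin.ext (Nat.eq_of_mul_eq_mul_left (by omega) h)
  have h1 : Function.Injective e1 := by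
    intro i j h
    simp only [e1, Fin.mk.injEq, add_left_inj] at h
    exact Fin.ext (Nat.eq_of_mul_eq_mul_left (by omega) h)
  have hdis : ∀ i j, e0 i ≠ e1 j := by
    intro i j h
    simp only [e0, e1, Fin.mk.injEq] at h
    have h2 := congrArg (· % d) h
    simp only [Nat.mul_mod_right, Nat.mul_add_mod] at h2
    rw [Nat.mod_eq_of_lt (by omega)] at h2
    omega
  let T0 : Finset (Fin (n + 1)) := Finset.univ.image e0
  let T1 : Finset (Fin (n + 1)) := Finset.univ.image e1
  have hT0 : ∀ m, e0 m ∈ T0 := fun m => Finset.mem_image_of_mem _ (Finset.mem_univ _)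
  have hT1 : ∀ m, e1 m ∈ T1 := fun m => Finset.mem_image_of_mem _ (Finset.mem_univ _)
  have hTd : Disjoint T0 T1 := by
    rw [Finset.disjoint_left]
    intro i hi hi'
    simp only [T0, T1, Finset.mem_image, Finset.mem_univ, true_and] at hi hi'
    obtain ⟨x, rfl⟩ := hi
    obtain ⟨y, hy⟩ := hi'
    exact hdis x y hy.symm
  set P := (Measure.pi fun _ : Fin (n + 1) => μ) with hP
  have hPp : IsProbabilityMeasure P := by rw [hP]; infer_instance
  let Y0 : (Fin (n + 1) → ℤ) → ℤ := fun a => ∑ m : Fin M, (m : ℤ) * a (e0 m)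
  let Y1 : (Fin (n + 1) → ℤ) → ℤ := fun a => ∑ m : Fin M, (m : ℤ) * a (e1 m)
  have hY01 : ProbabilityTheory.IndepFun Y0 Y1 P := by
    have := (indep_restrict μ T0 T1 hTd).comp
      (φ := fun x : T0 → ℤ => ∑ m : Fin M, (m : ℤ) * x ⟨e0 m, hT0 m⟩)
      (ψ := fun x : T1 → ℤ => ∑ m : Fin M, (m : ℤ) * x ⟨e1 m, hT1 m⟩)
      (measurable_of_countable _) (measurable_of_countable _)
    exact this
  have hind : ProbabilityTheory.IndepFun (fun (a : Fin (n + 1) → ℤ) (i : ((T0 ∪ T1)ᶜ : Finset _)) => a i)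
      (fun a => (Y0 a, Y1 a)) P := by
    have := (indep_restrict μ (T0 ∪ T1)ᶜ (T0 ∪ T1) disjoint_compl_left).comp
      (φ := id)
      (ψ := fun x : (T0 ∪ T1 : Finset _) → ℤ =>
        ((∑ m : Fin M, (m : ℤ) * x ⟨e0 m, Finset.mem_union_left _ (hT0 m)⟩ : ℤ),
         (∑ m : Fin M, (m : ℤ) * x ⟨e1 m, Finset.mem_union_right _ (hT1 m)⟩ : ℤ)))
      measurable_id (measurable_of_countable _)
    exact this
  refine cond_bound P _ _ (measurable_of_countable _) hind _ _ (by positivity) ?_ ?_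
  · rintro ⟨y0, y1⟩
    have e : {ω | (Y0 ω, Y1 ω) = (y0, y1)} = Y0 ⁻¹' {y0} ∩ Y1 ⁻¹' {y1} := by
      ext ω; simp
    rw [e, measureReal_def, hY01.measure_inter_preimage_eq_mul _ _ (MeasurableSet.singleton _) (MeasurableSet.singleton _),
      ENNReal.toReal_mul]
    have b0 := hsb e0 h0 y0
    have b1 := hsb e1 h1 y1
    have hsq : C ^ 2 / (M : ℝ) ^ 3 = C / Real.sqrt ((M : ℝ) ^ 3) * (C / Real.sqrt ((M : ℝ) ^ 3)) := by
      rw [div_mul_div_comm, Real.mul_self_sqrt (by positivity), sq]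
    rw [hsq]
    exact mul_le_mul b0 b1 ENNReal.toReal_nonneg (by positivity)
  · intro a ha b hb hab
    rw [Set.mem_ofPred_eq, double_iff] at ha hb
    have hab' : ∀ i, (∀ m, e0 m ≠ i) → (∀ m, e1 m ≠ i) → a i = b i := by
      intro i hi0 hi1
      have hi : i ∈ (T0 ∪ T1)ᶜ := by
        simp only [Finset.mem_compl, Finset.mem_union, T0, T1, Finset.mem_image, Finset.mem_univ, true_and, not_or, not_exists]
        exact ⟨hi0, hi1⟩
      exact congrFun hab ⟨i, hi⟩
    have hzd : ∀ m : ℕ, z ^ (d * m) = 1 := fun m => by rw [pow_mul, hz.pow_eq_one, one_pow]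
    have s1 : ∑ i : Fin (n + 1), ((a i : ℂ) - b i) * z ^ (i : ℕ) = 0 := by
      simp only [sub_mul, Finset.sum_sub_distrib]
      rw [← aeval_intPoly, ← aeval_intPoly, ha.1, hb.1, sub_zero]
    have s2 : ∑ i : Fin (n + 1), ((i : ℕ) : ℂ) * ((a i : ℂ) - b i) * z ^ (i : ℕ) = 0 := by
      simp only [mul_sub, sub_mul, Finset.sum_sub_distrib]
      rw [← aeval_deriv_intPoly, ← aeval_deriv_intPoly, ha.2, hb.2, sub_self]
    rw [sum_split e0 e1 h0 h1 hdis _ (fun i hi0 hi1 => by rw [hab' i hi0 hi1]; simp)] at s1 s2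
    simp only [e0, e1, pow_add, hzd, pow_one, one_mul, mul_one] at s1 s2
    set A0 : ℤ := ∑ m, (a (e0 m) - b (e0 m)) with hA0
    set A1 : ℤ := ∑ m, (a (e1 m) - b (e1 m)) with hA1
    have t1 : (A0 : ℂ) + A1 * z = 0 := by
      rw [← s1, hA0, hA1]; push_cast
      rw [Finset.sum_mul]
    have hA := prim_indep z d hd hz _ _ t1
    have t2 : ((d * (Y0 a - Y0 b) : ℤ) : ℂ) + ((d * (Y1 a - Y1 b) + A1 : ℤ) : ℂ) * z = 0 := by
      rw [← s2, hA1]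
      simp only [Y0, Y1]
      push_cast
      simp only [← Finset.sum_sub_distrib, Finset.mul_sum, Finset.sum_mul, ← Finset.sum_add_distrib]
      refine Finset.sum_congr rfl fun m _ => ?_
      simp only [e0, e1]
      ring
    have hB := prim_indep z d hd hz _ _ t2
    rw [hA.2, add_zero] at hB
    have hd0 : (d : ℤ) ≠ 0 := by exact_mod_cast (by omega : d ≠ 0)
    have c0 := (mul_eq_zero.1 hB.1).resolve_left hd0
    have c1 := (mul_eq_zero.1 hB.2).resolve_left hd0
    rw [Prod.mk.injEq]
    exact ⟨by linarith, by linarith⟩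

lemma caseC (μ : Measure ℤ) [IsProbabilityMeasure μ] (C : ℝ) (hC0 : 0 < C) (n M D : ℕ)
    (hsb : ∀ (e : Fin M → Fin (n + 1)), Function.Injective e → ∀ b : ℤ,
      (Measure.pi fun _ : Fin (n + 1) => μ).real {a | ∑ m : Fin M, (m : ℤ) * a (e m) = b} ≤ C / Real.sqrt ((M : ℝ) ^ 3))
    (hdM : D * M ≤ n + 1) :
    (Measure.pi fun _ : Fin (n + 1) => μ).real
      {a | ∃ z d, 3 ≤ d ∧ d ≤ D ∧ IsPrimitiveRoot z d ∧ isDoubleRootAt n a z} ≤ D ^ 2 * (C ^ 2 / (M : ℝ) ^ 3) := by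
  classical
  have hsub : {a | ∃ z d, 3 ≤ d ∧ d ≤ D ∧ IsPrimitiveRoot z d ∧ isDoubleRootAt n a z} ⊆
      ⋃ d ∈ Finset.Icc 3 D, ⋃ z ∈ primitiveRoots d ℂ, {a | isDoubleRootAt n a z} := by
    rintro a ⟨z, d, h3, hD, hz, ha⟩
    simp only [Set.mem_iUnion]
    exact ⟨d, Finset.mem_Icc.2 ⟨h3, hD⟩, z, (mem_primitiveRoots (by omega)).2 hz, ha⟩
  refine (measureReal_mono hsub (measure_ne_top _ _)).trans ((measureReal_biUnion_finset_le _ _).trans ?_)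
  have hterm : ∀ d ∈ Finset.Icc 3 D, (Measure.pi fun _ : Fin (n + 1) => μ).real
      (⋃ z ∈ primitiveRoots d ℂ, {a | isDoubleRootAt n a z}) ≤ D * (C ^ 2 / (M : ℝ) ^ 3) := by
    intro d hd
    rw [Finset.mem_Icc] at hd
    refine (measureReal_biUnion_finset_le _ _).trans ?_
    refine (Finset.sum_le_sum fun z hz => caseC_one μ C hC0 n M d hsb hd.1
      ((Nat.mul_le_mul_right _ hd.2).trans hdM) z ((mem_primitiveRoots (by omega)).1 hz)).trans ?_
    rw [Finset.sum_const, nsmul_eq_mul]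
    gcongr
    rw [Complex.card_primitiveRoots]
    exact (Nat.totient_le d).trans hd.2
  refine (Finset.sum_le_sum hterm).trans ?_
  rw [Finset.sum_const, nsmul_eq_mul, sq (D : ℝ), mul_assoc]
  gcongr
  simp

lemma good_ae (μ : Measure ℤ) [IsProbabilityMeasure μ] (hsupp : μ (({-1, 0, 1} : Set ℤ)ᶜ) = 0) (n : ℕ) :
    (Measure.pi fun _ : Fin (n + 1) => μ).real {a | ¬ Good n a} = 0 := by
  have hsub : {a | ¬ Good n a} ⊆ ⋃ i : Fin (n + 1), (Function.eval i) ⁻¹' (({-1, 0, 1} : Set ℤ)ᶜ) := by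
    intro a ha
    simp only [Set.mem_ofPred_eq, Good, not_forall] at ha
    obtain ⟨i, hi⟩ := ha
    exact Set.mem_iUnion.2 ⟨i, by simpa using hi⟩
  rw [measureReal_def]
  have : (Measure.pi fun _ : Fin (n + 1) => μ) {a | ¬ Good n a} = 0 := by
    refine measure_mono_null hsub (measure_iUnion_null fun i => ?_)
    rw [(measurePreserving_eval (fun _ : Fin (n + 1) => μ) i).measure_preimage (MeasurableSet.of_discrete).nullMeasurableSet]
    exact hsupp
  rw [this]; rfl

lemma total_bound (μ : Measure ℤ) [IsProbabilityMeasure μ] (hsupp : μ (({-1, 0, 1} : Set ℤ)ᶜ) = 0)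
    (p : ℝ) (hp0 : 0 ≤ p) (hp1 : p ≤ 1) (hp3 : 3 * p ^ 2 ≤ 1) (hp : ∀ x, μ.real {x} ≤ p)
    (C : ℝ) (hC0 : 0 < C)
    (hsb : ∀ M : ℕ, 2 ≤ M → ∀ (N : ℕ) (e : Fin M → Fin N), Function.Injective e → ∀ b : ℤ,
      (Measure.pi fun _ : Fin N => μ).real {a | ∑ m : Fin M, (m : ℤ) * a (e m) = b} ≤ C / Real.sqrt ((M : ℝ) ^ 3))
    (n N : ℕ) (hN : 2 ≤ N) (hn : N ^ 20 ≤ n) :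
    ((Measure.pi fun _ : Fin (n + 1) => μ) {a | hasDoubleRoot n a}).toReal -
         ((Measure.pi fun _ : Fin (n + 1) => μ)
            {a | isDoubleRootAt n a (-1) ∨ isDoubleRootAt n a 0 ∨ isDoubleRootAt n a 1}).toReal
      ≤ n * (3 * p ^ 2) ^ N + (2 * 4 ^ N + 1 : ℝ) ^ (N + 1) * p ^ (n / (48 * N ^ 2))
        + (2 * (N : ℝ) ^ 2) ^ 2 * (C ^ 2 / ((N : ℝ) ^ 17) ^ 3) := by
  have hA := caseA μ p hp0 hp3 hp n N
  have hB := caseB μ p hp0 hp1 hp n N (by omega)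
  have hM : 2 ≤ N ^ 17 := hN.trans (Nat.le_self_pow (by norm_num) N)
  have hDM : 2 * N ^ 2 * N ^ 17 ≤ n + 1 := by
    have : 2 * N ^ 2 * N ^ 17 ≤ N ^ 20 := by
      calc 2 * N ^ 2 * N ^ 17 ≤ N * N ^ 2 * N ^ 17 := by gcongr
        _ = N ^ 20 := by ring
    omega
  have hCc := caseC μ C hC0 n (N ^ 17) (2 * N ^ 2) (hsb _ hM (n + 1)) hDM
  have hG := good_ae μ hsupp n
  push_cast at hCc
  have hsub : {a | hasDoubleRoot n a} ⊆
    {a | isDoubleRootAt n a (-1) ∨ isDoubleRootAt n a 0 ∨ isDoubleRootAt n a 1} ∪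
    ({a | ¬ Good n a} ∪
    ({a | Good n a ∧ intPoly n a ≠ 0 ∧ ∃ f : Polynomial ℤ, f.Monic ∧ N < f.natDegree ∧ f ^ 2 ∣ intPoly n a} ∪
    ({a | Good n a ∧ intPoly n a ≠ 0 ∧ ∃ w : ℂ, IsIntegral ℤ w ∧ Polynomial.aeval w (intPoly n a) = 0 ∧
        1 + 1 / (24 * (N:ℝ) ^ 2) ≤ ‖w‖ ∧ (minpoly ℤ w).natDegree ≤ N} ∪
     {a | ∃ z d, 3 ≤ d ∧ d ≤ 2 * N ^ 2 ∧ IsPrimitiveRoot z d ∧ isDoubleRootAt n a z}))) := by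
    rintro a ⟨z, hz⟩
    by_cases hs : isDoubleRootAt n a (-1) ∨ isDoubleRootAt n a 0 ∨ isDoubleRootAt n a 1
    · exact Or.inl hs
    refine Or.inr ?_
    by_cases hg : Good n a
    swap
    · exact Or.inl hg
    refine Or.inr ?_
    push Not at hs
    have hP0 : intPoly n a ≠ 0 := by
      intro h
      apply hs.2.1
      rw [double_iff, h]; simp
    have hz' := (double_iff n a z).1 hz
    have hint := good_integral n a hg hP0 z hz'.1
    by_cases hdeg : N < (minpoly ℤ z).natDegree
    · exact Or.inl ⟨hg, hP0, _, minpoly.monic hint, hdeg, minpoly_sq_dvd _ z hint hz'.1 hz'.2⟩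
    refine Or.inr ?_
    have hz0 : z ≠ 0 := by rintro rfl; exact hs.2.1 hz
    rcases trichotomy (intPoly n a) z hint hz0 hz'.1 N (by omega) (by omega) with h | ⟨d, hd0, hd, hpr⟩
    · exact Or.inl ⟨hg, hP0, h⟩
    · refine Or.inr ⟨z, d, ?_, hd, hpr, hz⟩
      by_contra hlt
      have : d = 1 ∨ d = 2 := by omega
      rcases this with rfl | rfl
      · rw [IsPrimitiveRoot.one_right_iff] at hpr
        rw [hpr] at hz; exact hs.2.2 hz
      · have := hpr.eq_neg_one_of_two_right
        rw [this] at hz; exact hs.1 hz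
  have h1 := measureReal_mono hsub (measure_ne_top (Measure.pi fun _ : Fin (n + 1) => μ) _)
  have h2 := fun s t => measureReal_union_le (μ := (Measure.pi fun _ : Fin (n + 1) => μ)) s t
  have h3 := h1.trans ((h2 _ _).trans (add_le_add_right ((h2 _ _).trans (add_le_add_right ((h2 _ _).trans (add_le_add_right (h2 _ _) _)) _)) _))
  simp only [measureReal_def] at *
  linarith

lemma tends_poly_geom (k : ℕ) (r : ℝ) (h0 : 0 ≤ r) (h1 : r < 1) :
    Tendsto (fun N : ℕ => (2 * (N : ℝ)) ^ k * r ^ N) atTop (nhds 0) := by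
  have := (tendsto_pow_const_mul_const_pow_of_lt_one k h0 h1).const_mul ((2:ℝ) ^ k)
  rw [mul_zero] at this
  refine this.congr fun N => ?_
  rw [mul_pow]; ring

lemma tends_B (p : ℝ) (h0 : 0 ≤ p) (h1 : p < 1) :
    Tendsto (fun N : ℕ => (2 * (N : ℝ)) ^ 40 * ((2 * 4 ^ N + 1 : ℝ) ^ (N + 1) * p ^ (N ^ 17))) atTop (nhds 0) := by
  have hlim := tends_poly_geom 40 (1/2) (by norm_num) (by norm_num)
  have hp : ∀ᶠ N : ℕ in atTop, 256 * p ^ N ≤ 1 / 2 := by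
    have := (tendsto_pow_atTop_nhds_zero_of_lt_one h0 h1).const_mul 256
    rw [mul_zero] at this
    exact (this.eventually (gt_mem_nhds (by norm_num : (0:ℝ) < 1/2))).mono fun _ h => h.le
  refine tendsto_of_tendsto_of_tendsto_of_le_of_le' tendsto_const_nhds hlim
    (Eventually.of_forall fun N => by positivity) ?_
  filter_upwards [hp, eventually_ge_atTop 1] with N hN hN1
  gcongr
  have a1 : (2 * 4 ^ N + 1 : ℝ) ≤ 4 ^ (2 * N) := by
    rw [two_mul N, pow_add]
    have : (4:ℝ) ≤ 4 ^ N := by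
      calc (4:ℝ) = 4 ^ 1 := by norm_num
        _ ≤ 4 ^ N := pow_le_pow_right₀ (by norm_num) hN1
    nlinarith
  calc (2 * 4 ^ N + 1 : ℝ) ^ (N + 1) * p ^ (N ^ 17)
      ≤ (4 ^ (2 * N)) ^ (2 * N) * p ^ (N * N ^ 2) := by
        have b1 : (2 * 4 ^ N + 1 : ℝ) ^ (N + 1) ≤ (4 ^ (2 * N)) ^ (2 * N) :=
          (pow_le_pow_left₀ (by positivity) a1 _).trans
            (pow_le_pow_right₀ (one_le_pow₀ (by norm_num)) (by omega))
        have b2 : p ^ (N ^ 17) ≤ p ^ (N * N ^ 2) := by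
          refine pow_le_pow_of_le_one h0 h1.le ?_
          calc N * N ^ 2 = N ^ 3 := by ring
            _ ≤ N ^ 17 := Nat.pow_le_pow_right hN1 (by norm_num)
        gcongr
    _ = (256 * p ^ N) ^ (N ^ 2) := by
        rw [mul_pow, ← pow_mul, ← pow_mul, show (256:ℝ) = 4 ^ 4 by norm_num, ← pow_mul]
        congr 2; ring
    _ ≤ (1 / 2) ^ (N ^ 2) := by gcongr
    _ ≤ (1 / 2) ^ N := by
        refine pow_le_pow_of_le_one (by norm_num) (by norm_num) ?_
        nlinarith

lemma tends_C (C : ℝ) :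
    Tendsto (fun N : ℕ => (2 * (N : ℝ)) ^ 40 * ((2 * (N : ℝ) ^ 2) ^ 2 * (C ^ 2 / ((N : ℝ) ^ 17) ^ 3))) atTop (nhds 0) := by
  have : Tendsto (fun N : ℕ => (2 ^ 42 * C ^ 2) * (((N : ℝ)⁻¹) ^ 7)) atTop (nhds 0) := by
    have := ((tendsto_inv_atTop_nhds_zero_nat (𝕜 := ℝ)).pow 7).const_mul (2 ^ 42 * C ^ 2)
    simpa using this
  refine this.congr' ?_
  filter_upwards [eventually_ge_atTop 1] with N hN
  have : (N : ℝ) ≠ 0 := by positivity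
  field_simp

lemma exists_scale : ∃ N : ℕ → ℕ, Tendsto N atTop atTop ∧ ∀ n, 1 ≤ n → N n ^ 20 ≤ n ∧ n ≤ (2 * N n) ^ 20 := by
  classical
  refine ⟨fun n => Nat.findGreatest (fun N => N ^ 20 ≤ n) n, ?_, ?_⟩
  · rw [tendsto_atTop]
    intro b
    filter_upwards [eventually_ge_atTop (b ^ 20)] with n hn
    exact Nat.le_findGreatest ((Nat.le_self_pow (by norm_num) b).trans hn) hn
  · intro n hn
    set N := Nat.findGreatest (fun N => N ^ 20 ≤ n) n with hN
    have h1 : 1 ≤ N := Nat.le_findGreatest hn (by simpa using hn)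
    have h2 : N ^ 20 ≤ n := Nat.findGreatest_spec (P := fun N => N ^ 20 ≤ n) hn (by simpa using hn)
    refine ⟨h2, ?_⟩
    by_contra hlt
    push Not at hlt
    have h3 : (N + 1) ^ 20 ≤ (2 * N) ^ 20 := Nat.pow_le_pow_left (by omega) _
    have h4 : N + 1 ≤ N := by
      have h5 : (N + 1) ^ 20 ≤ n := h3.trans hlt.le
      exact Nat.le_findGreatest ((Nat.le_self_pow (by norm_num) _).trans h5) h5
    omega

/-- Up to an `o(n⁻²)` error, the probability that the random polynomial `P_n` has a double
root equals the probability that at least one of `-1, 0, 1` is a double root of `P_n`. -/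
theorem double_root_reduction (μ : MeasureTheory.Measure ℤ) [IsProbabilityMeasure μ]
    (hsupp : μ (({-1, 0, 1} : Set ℤ)ᶜ) = 0)
    (hC : ∀ x ∈ ({-1, 0, 1} : Set ℤ), (μ {x}).toReal < 1 / Real.sqrt 3) :
    Tendsto (fun n : ℕ => (n : ℝ) ^ 2 *
        (((Measure.pi fun _ : Fin (n + 1) => μ) {a | hasDoubleRoot n a}).toReal -
         ((Measure.pi fun _ : Fin (n + 1) => μ)
            {a | isDoubleRootAt n a (-1) ∨ isDoubleRootAt n a 0 ∨ isDoubleRootAt n a 1}).toReal))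
      atTop (nhds 0) := by
  have hC' : ∀ x ∈ ({-1, 0, 1} : Set ℤ), μ.real {x} < 1 / Real.sqrt 3 := hC
  have hs3 : 1 / Real.sqrt 3 < 1 := by
    rw [div_lt_one (by positivity)]
    exact Real.lt_sqrt_of_sq_lt (by norm_num)
  obtain ⟨p, hp0, hp, hps⟩ : ∃ p : ℝ, 0 ≤ p ∧ (∀ x, μ.real {x} ≤ p) ∧ p < 1 / Real.sqrt 3 := by
    refine ⟨max (μ.real {-1}) (max (μ.real {0}) (μ.real {1})), ?_, ?_, ?_⟩
    · exact le_max_of_le_left measureReal_nonneg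
    · intro x
      by_cases hx : x ∈ ({-1, 0, 1} : Set ℤ)
      · rcases hx with rfl | rfl | rfl
        · exact le_max_left _ _
        · exact le_max_of_le_right (le_max_left _ _)
        · exact le_max_of_le_right (le_max_right _ _)
      · have : μ {x} = 0 := measure_mono_null (Set.singleton_subset_iff.2 hx) hsupp
        rw [measureReal_def, this]
        exact le_max_of_le_left measureReal_nonneg
    · exact max_lt (hC' _ (by simp)) (max_lt (hC' _ (by simp)) (hC' _ (by simp)))
  have hp1 : p < 1 := hps.trans hs3
  have hp3 : 3 * p ^ 2 < 1 := by
    have : p ^ 2 < (1 / Real.sqrt 3) ^ 2 := by gcongr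
    rw [div_pow, Real.sq_sqrt (by norm_num)] at this
    linarith
  obtain ⟨C, hC0, hsb⟩ := small_ball μ hsupp (fun x hx => (hC' x hx).trans hs3)
  obtain ⟨N, hN, hNn⟩ := exists_scale
  have hlim := (((tends_poly_geom 60 (3 * p ^ 2) (by positivity) hp3).add (tends_B p hp0 hp1)).add (tends_C C)).comp hN
  simp only [add_zero] at hlim
  refine tendsto_of_tendsto_of_tendsto_of_le_of_le' tendsto_const_nhds hlim ?_ ?_
  · refine Eventually.of_forall fun n => mul_nonneg (by positivity) (sub_nonneg.2 ?_)
    refine ENNReal.toReal_mono (measure_ne_top _ _) (measure_mono ?_)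
    rintro a (h | h | h)
    exacts [⟨_, h⟩, ⟨_, h⟩, ⟨_, h⟩]
  · filter_upwards [eventually_ge_atTop 1, hN.eventually_ge_atTop 48] with n hn1 hN48
    obtain ⟨hl, hu⟩ := hNn n hn1
    have hb := total_bound μ hsupp p hp0 hp1.le hp3.le hp C hC0 hsb n (N n) (by omega) hl
    have hu' : (n : ℝ) ≤ (2 * (N n : ℝ)) ^ 20 := by exact_mod_cast hu
    have hsq : (n : ℝ) ^ 2 ≤ (2 * (N n : ℝ)) ^ 40 := by
      calc (n : ℝ) ^ 2 ≤ ((2 * (N n : ℝ)) ^ 20) ^ 2 := by gcongr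
        _ = _ := by rw [← pow_mul]
    have hcu : (n : ℝ) ^ 2 * n ≤ (2 * (N n : ℝ)) ^ 60 := by
      calc (n : ℝ) ^ 2 * n ≤ (2 * (N n : ℝ)) ^ 40 * (2 * (N n : ℝ)) ^ 20 := by gcongr
        _ = _ := by rw [← pow_add]
    have hexp : N n ^ 17 ≤ n / (48 * N n ^ 2) := by
      rw [Nat.le_div_iff_mul_le (by positivity)]
      refine le_trans ?_ hl
      calc N n ^ 17 * (48 * N n ^ 2) ≤ N n ^ 17 * (N n * N n ^ 2) := by gcongr
        _ = N n ^ 20 := by ring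
    have hpe : p ^ (n / (48 * N n ^ 2)) ≤ p ^ (N n ^ 17) := pow_le_pow_of_le_one hp0 hp1.le hexp
    simp only [Function.comp]
    refine (mul_le_mul_of_nonneg_left hb (by positivity)).trans ?_
    rw [mul_add, mul_add]
    refine add_le_add (add_le_add ?_ ?_) ?_
    · rw [← mul_assoc]; gcongr
    · gcongr
    · gcongr
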